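/- arXiv:1603.04187 — 3 statements merged into one kernel-verified Lean document; each statement's English description precedes it below -/
import Mathlib

section
/- For each integer r ≥ 2 let f_r(z) := Σ_{n≥0} C(2n,n)^r z^n, where C(2n,n) is the central binomial coefficient. Then the family {f_r : r ≥ 2} is algebraically independent over ℂ(z); that is, for every n and every choice of distinct integers r_1, …, r_n ≥ 2, the functions f_{r_1}, …, f_{r_n} are algebraically independent over ℂ(z). -/
/-- The power series `f_r(z) = ∑_{n≥0} C(2n,n)^r zⁿ`. -/
noncomputable def centralBinomPow (r : ℕ) : PowerSeries ℂ :=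
  PowerSeries.mk fun n => (Nat.centralBinom n : ℂ) ^ r


namespace CBP
open Polynomial

abbrev I := {r : ℕ // 2 ≤ r}

noncomputable def cb (R : Type*) [CommRing R] (r : ℕ) : PowerSeries R :=
  PowerSeries.mk fun n => (Nat.centralBinom n : R) ^ r

noncomputable def mon (R : Type*) [CommRing R] (d : I →₀ ℕ) : PowerSeries R :=
  ∏ i ∈ d.support, cb R i.1 ^ d i

lemma map_cb {R S : Type*} [CommRing R] [CommRing S] (f : R →+* S) (r : ℕ) :
    PowerSeries.map f (cb R r) = cb S r := by
  ext n
  simp [cb]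

lemma map_mon {R S : Type*} [CommRing R] [CommRing S] (f : R →+* S) (d : I →₀ ℕ) :
    PowerSeries.map f (mon R d) = mon S d := by
  simp [mon, map_cb]

lemma dep_iff_det {K : Type*} [Field K] {ι : Type*} [Fintype ι] [DecidableEq ι] (v : ι → ℕ → K) :
    (∃ c : ι → K, c ≠ 0 ∧ ∀ n, ∑ i, c i * v i n = 0) ↔
      ∀ s : ι → ℕ, (Matrix.of fun i j => v i (s j)).det = 0 := by
  constructor
  · rintro ⟨c, hc, h⟩ s
    rw [← Matrix.exists_vecMul_eq_zero_iff]
    refine ⟨c, hc, ?_⟩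
    ext j
    simpa [Matrix.vecMul, dotProduct] using h (s j)
  · intro h
    by_contra hcon
    let w : ℕ → (ι → K) := fun n i => v i n
    have htop : Submodule.span K (Set.range w) = ⊤ := by
      by_contra hne
      obtain ⟨f, hf, hker⟩ := Submodule.exists_le_ker_of_lt_top _ (lt_top_iff_ne_top.2 hne)
      have key : ∀ x : ι → K, f x = ∑ i, f (Pi.single i 1) * x i := by
        intro x
        rw [LinearMap.pi_apply_eq_sum_univ f x]
        refine Finset.sum_congr rfl fun i _ => ?_
        rw [smul_eq_mul, mul_comm]
        congr 2
        ext j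
        simp [Pi.single_apply, eq_comm]
      apply hcon
      refine ⟨fun i => f (Pi.single i 1), ?_, fun n => ?_⟩
      · intro h0
        apply hf
        ext x
        simpa using congrFun h0 x
      · have := hker (Submodule.subset_span ⟨n, rfl⟩)
        rw [LinearMap.mem_ker, key] at this
        exact this
    obtain ⟨κ, a, ha, hsp, hli⟩ := exists_linearIndependent' K w
    let b := Module.Basis.mk hli (by rw [hsp, htop])
    let e : κ ≃ ι := b.indexEquiv (Pi.basisFun K ι)
    have hli2 : LinearIndependent K ((w ∘ a) ∘ e.symm) := hli.comp _ e.symm.injective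
    have h0 := h (a ∘ e.symm)
    rw [← Matrix.exists_mulVec_eq_zero_iff] at h0
    obtain ⟨c, hc, h0⟩ := h0
    apply hc
    rw [Fintype.linearIndependent_iff] at hli2
    funext j
    refine hli2 c ?_ j
    ext i
    have := congrFun h0 i
    simpa [Matrix.mulVec, dotProduct, w, mul_comm] using this

def Dep (K : Type*) [Field K] (S : Finset (I →₀ ℕ)) (N : ℕ) : Prop :=
  ∃ c : (I →₀ ℕ) → K[X], (∃ d ∈ S, c d ≠ 0) ∧ (∀ d ∈ S, (c d).degree < N) ∧
    ∑ d ∈ S, (c d : PowerSeries K) * mon K d = 0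

noncomputable def minor (S : Finset (I →₀ ℕ)) (N : ℕ) (s : S × Fin N → ℕ) : ℤ :=
  (Matrix.of fun (i j : S × Fin N) =>
    PowerSeries.coeff (s j) (PowerSeries.X ^ (i.2 : ℕ) * mon ℤ i.1.1)).det

lemma dep_iff_minor (K : Type*) [Field K] (S : Finset (I →₀ ℕ)) (N : ℕ) :
    Dep K S N ↔ ∀ s, ((minor S N s : ℤ) : K) = 0 := by
  classical
  have h1 : ∀ s, ((minor S N s : ℤ) : K) = (Matrix.of fun (i j : S × Fin N) =>
      (fun (i : S × Fin N) n =>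
        PowerSeries.coeff n (PowerSeries.X ^ (i.2 : ℕ) * mon K i.1.1)) i (s j)).det := by
    intro s
    rw [minor, ← eq_intCast (Int.castRingHom K), RingHom.map_det]
    congr 1
    ext i j
    simp only [RingHom.mapMatrix_apply, Matrix.map_apply, Matrix.of_apply,
      ← PowerSeries.coeff_map, map_mul, map_pow, PowerSeries.map_X, map_mon]
  have h2 : (∀ s, ((minor S N s : ℤ) : K) = 0) ↔ ∀ s : S × Fin N → ℕ, (Matrix.of fun (i j : S × Fin N) =>
      (fun (i : S × Fin N) n =>
        PowerSeries.coeff n (PowerSeries.X ^ (i.2 : ℕ) * mon K i.1.1)) i (s j)).det = 0 :=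
    forall_congr' fun s => by rw [h1 s]
  rw [h2, ← dep_iff_det (fun (i : S × Fin N) n =>
        PowerSeries.coeff n (PowerSeries.X ^ (i.2 : ℕ) * mon K i.1.1))]
  constructor
  · rintro ⟨c, ⟨d, hd, hne⟩, hdeg, hsum⟩
    refine ⟨fun i => (c i.1.1).coeff i.2, ?_, ?_⟩
    · intro h0
      apply hne
      ext n
      by_cases hn : n < N
      · exact congrFun h0 (⟨d, hd⟩, ⟨n, hn⟩)
      · rw [Polynomial.coeff_zero]
        apply Polynomial.coeff_eq_zero_of_degree_lt
        exact (hdeg d hd).trans_le (by exact_mod_cast not_lt.1 hn)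
    · intro n
      have hs := congrArg (PowerSeries.coeff n) hsum
      rw [map_sum, ← Finset.sum_coe_sort, map_zero] at hs
      rw [Fintype.sum_prod_type, ← hs]
      refine Finset.sum_congr rfl fun x _ => ?_
      have hx : (c x.1 : PowerSeries K) =
          ∑ k : Fin N, PowerSeries.C ((c x.1).coeff k) * PowerSeries.X ^ (k : ℕ) := by
        conv_lhs => rw [Polynomial.as_sum_range' (c x.1) N (by
          by_cases h0 : c x.1 = 0
          · have := hdeg x.1 x.2
            rcases Nat.eq_zero_or_pos N with h | h
            · subst h
              exfalso
              have hh := hdeg d hd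
              exact hne (Polynomial.degree_eq_bot.1 (by
                by_contra hb
                rw [Polynomial.degree_eq_natDegree hne] at hh
                exact absurd hh (by simp)))
            · simpa [h0] using h
          · exact (Polynomial.natDegree_lt_iff_degree_lt h0).2 (hdeg x.1 x.2))]
        rw [← Polynomial.coeToPowerSeries.ringHom_apply, map_sum, Finset.sum_range]
        refine Finset.sum_congr rfl fun k _ => ?_
        rw [← Polynomial.C_mul_X_pow_eq_monomial]
        simp
      rw [hx, Finset.sum_mul, map_sum]
      refine Finset.sum_congr rfl fun k _ => ?_
      rw [mul_assoc, PowerSeries.coeff_C_mul]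
  · rintro ⟨c, hc, h⟩
    let q : (I →₀ ℕ) → K[X] := fun d => if hd : d ∈ S then
      ∑ k : Fin N, Polynomial.C (c (⟨d, hd⟩, k)) * Polynomial.X ^ (k : ℕ) else 0
    have hq : ∀ x : S, q x.1 =
      ∑ k : Fin N, Polynomial.C (c (x, k)) * Polynomial.X ^ (k : ℕ) := by
      intro x
      simp [q]
    have hqc : ∀ (x : S) (k : Fin N), (q x.1).coeff k = c (x, k) := by
      intro x k
      rw [hq, Polynomial.finsetSum_coeff]
      simp [Polynomial.coeff_X_pow, Fin.val_inj]
    refine ⟨q, ?_, ?_, ?_⟩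
    · obtain ⟨⟨x, k⟩, hxk⟩ := Function.ne_iff.1 hc
      refine ⟨x.1, x.2, fun h0 => hxk ?_⟩
      rw [← hqc, h0]; simp
    · intro d hd
      rw [hq ⟨d, hd⟩]
      refine (Polynomial.degree_sum_fin_lt _)
    · ext n
      rw [map_sum, ← Finset.sum_coe_sort, map_zero, ← h n, Fintype.sum_prod_type]
      refine Finset.sum_congr rfl fun x _ => ?_
      rw [hq, ← Polynomial.coeToPowerSeries.ringHom_apply, map_sum, Finset.sum_mul, map_sum]
      refine Finset.sum_congr rfl fun k _ => ?_
      rw [RingHom.map_mul, RingHom.map_pow]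
      simp only [Polynomial.coeToPowerSeries.ringHom_apply, Polynomial.coe_C, Polynomial.coe_X]
      rw [mul_assoc, PowerSeries.coeff_C_mul]

lemma dep_zmod {S : Finset (I →₀ ℕ)} {N : ℕ} (h : Dep ℂ S N) (p : ℕ) [Fact p.Prime] :
    Dep (ZMod p) S N := by
  rw [dep_iff_minor] at h ⊢
  intro s
  have := h s
  rw [Int.cast_eq_zero] at this
  simp [this]

lemma dep_real {S : Finset (I →₀ ℕ)} {N : ℕ} (h : ¬ Dep ℝ S N) :
    {p : ℕ | ∃ _ : Fact p.Prime, Dep (ZMod p) S N}.Finite := by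
  rw [dep_iff_minor] at h
  push Not at h
  obtain ⟨s, hs⟩ := h
  rw [Int.cast_ne_zero] at hs
  refine (Set.finite_le_nat (minor S N s).natAbs).subset ?_
  rintro p ⟨hp, hd⟩
  rw [dep_iff_minor] at hd
  have := hd s
  rw [ZMod.intCast_zmod_eq_zero_iff_dvd] at this
  exact Nat.le_of_dvd (Int.natAbs_pos.2 hs) (Int.natCast_dvd.1 this)

lemma exists_dep {P : MvPolynomial I ℂ[X]} (hP : P ≠ 0)
    (h : MvPolynomial.aeval (fun r : I => cb ℂ r.1) P = 0) :
    ∃ S N, Dep ℂ S N := by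
  refine ⟨P.support, (P.support.sup fun d => (P.coeff d).natDegree) + 1, fun d => P.coeff d,
    ?_, ?_, ?_⟩
  · obtain ⟨d, hd⟩ := MvPolynomial.support_nonempty.2 hP
    exact ⟨d, hd, MvPolynomial.mem_support_iff.1 hd⟩
  · intro d hd
    refine Polynomial.degree_le_natDegree.trans_lt ?_
    have := Finset.le_sup (f := fun d => (P.coeff d).natDegree) hd
    exact_mod_cast Nat.lt_succ_of_le this
  · rw [MvPolynomial.aeval_def, MvPolynomial.eval₂_eq] at h
    rw [← h]
    refine Finset.sum_congr rfl fun d _ => ?_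
    simp [mon, PowerSeries.algebraMap_apply']

lemma centralBinom_lucas (p : ℕ) [hp : Fact p.Prime] (n : ℕ) :
    (Nat.centralBinom n : ZMod p) = Nat.centralBinom (n % p) * Nat.centralBinom (n / p) := by
  have key : ∀ a b : ℕ, ((a.choose b : ℕ) : ZMod p) =
      (((a % p).choose (b % p) : ℕ) : ZMod p) * (((a / p).choose (b / p) : ℕ) : ZMod p) := by
    intro a b
    have := Choose.choose_modEq_choose_mod_mul_choose_div (n := a) (k := b) (p := p)
    have h := (ZMod.intCast_eq_intCast_iff _ _ p).2 this
    exact_mod_cast h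
  have hp0 := hp.out.pos
  simp only [Nat.centralBinom_eq_two_mul_choose]
  have ha : n % p < p := Nat.mod_lt _ hp0
  rw [key (2 * n) n]
  have hn := Nat.mod_add_div n p
  set a := n % p
  set b := n / p
  by_cases h : 2 * a < p
  · have h1 : 2 * n = 2 * a + p * (2 * b) := by rw [← hn]; ring
    rw [h1, Nat.add_mul_mod_self_left, Nat.mod_eq_of_lt h, Nat.add_mul_div_left _ _ hp0,
      Nat.div_eq_of_lt h, zero_add]
  · have h1 : 2 * n = (2 * a - p) + p * (2 * b + 1) := by
      have : 2 * a = (2 * a - p) + p := by omega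
      calc 2 * n = 2 * a + p * (2 * b) := by rw [← hn]; ring
        _ = (2 * a - p) + p + p * (2 * b) := by rw [← this]
        _ = _ := by ring
    have h2 : 2 * a - p < p := by omega
    have h3 : 2 * a - p < a := by omega
    have h4 : (2 * a).choose a % p = 0 → True := fun _ => trivial
    have h5 : (2 * a) % p = 2 * a - p := by
      rw [Nat.mod_eq_sub_mod (by omega), Nat.mod_eq_of_lt h2]
    rw [key (2 * a) a, h5, h1, Nat.add_mul_mod_self_left, Nat.mod_eq_of_lt h2,
      Nat.mod_eq_of_lt ha, Nat.choose_eq_zero_of_lt h3]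
    simp

lemma cb_pow_p (p : ℕ) [hp : Fact p.Prime] (f : PowerSeries (ZMod p)) :
    f ^ p = PowerSeries.expand p hp.out.ne_zero f := by
  have h := MvPowerSeries.map_frobenius_expand (σ := Unit) p hp.out.ne_zero (f := f)
  rw [ZMod.frobenius_zmod, MvPowerSeries.map_id] at h
  exact h.symm

lemma cb_A (p : ℕ) [hp : Fact p.Prime] (r : ℕ) :
    ∃ A : (ZMod p)[X], A.natDegree ≤ p - 1 ∧ (A : PowerSeries (ZMod p)) * cb (ZMod p) r ^ (p - 1) = 1 := by
  have hp0 := hp.out.pos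
  refine ⟨PowerSeries.trunc p (cb (ZMod p) r), ?_, ?_⟩
  · have := PowerSeries.natDegree_trunc_lt (cb (ZMod p) r) (p - 1)
    rw [Nat.sub_add_cancel hp0] at this
    omega
  · have h1 : (PowerSeries.trunc p (cb (ZMod p) r) : PowerSeries (ZMod p)) * cb (ZMod p) r ^ p
        = cb (ZMod p) r := by
      rw [cb_pow_p]
      ext n
      rw [PowerSeries.coeff_mul, Finset.sum_eq_single (n % p, p * (n / p))]
      · simp only [Polynomial.coeff_coe, PowerSeries.coeff_trunc, Nat.mod_lt _ hp0, if_true,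
          PowerSeries.coeff_expand_mul]
        simp only [cb, PowerSeries.coeff_mk]
        rw [centralBinom_lucas p n, mul_pow]
      · rintro ⟨i, j⟩ hij hne
        rw [Finset.HasAntidiagonal.mem_antidiagonal] at hij
        simp only [Polynomial.coeff_coe, PowerSeries.coeff_trunc, PowerSeries.coeff_expand]
        by_cases h1 : i < p
        · by_cases h2 : p ∣ j
          · exfalso
            obtain ⟨k, rfl⟩ := h2
            apply hne
            simp only at hij
            subst hij
            rw [Nat.add_mul_mod_self_left, Nat.mod_eq_of_lt h1, Nat.add_mul_div_left _ _ hp0,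
              Nat.div_eq_of_lt h1, zero_add]
          · simp [h2]
        · simp [h1]
      · intro h
        exact absurd (Finset.HasAntidiagonal.mem_antidiagonal.2 (Nat.mod_add_div n p)) h
    have hne : cb (ZMod p) r ≠ 0 := by
      intro h0
      have := congrArg (PowerSeries.coeff 0) h0
      simp [cb] at this
    apply mul_right_cancel₀ hne
    rw [mul_assoc, ← pow_succ, Nat.sub_add_cancel hp0, h1, one_mul]

lemma mon_A (p : ℕ) [hp : Fact p.Prime] (d : I →₀ ℕ) :
    ∃ b : (ZMod p)[X], b.natDegree ≤ (p - 1) * (∑ i ∈ d.support, d i) ∧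
      (b : PowerSeries (ZMod p)) * mon (ZMod p) d ^ (p - 1) = 1 := by
  choose A hA1 hA2 using fun r => cb_A p r
  refine ⟨∏ i ∈ d.support, A i.1 ^ d i, ?_, ?_⟩
  · refine (Polynomial.natDegree_prod_le _ _).trans ?_
    rw [Finset.mul_sum]
    refine Finset.sum_le_sum fun i _ => ?_
    refine Polynomial.natDegree_pow_le.trans ?_
    rw [mul_comm]
    exact Nat.mul_le_mul_right _ (hA1 _)
  · rw [mon, ← Polynomial.coeToPowerSeries.ringHom_apply, map_prod, ← Finset.prod_pow,
      ← Finset.prod_mul_distrib]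
    refine Finset.prod_eq_one fun i _ => ?_
    rw [map_pow, Polynomial.coeToPowerSeries.ringHom_apply, pow_right_comm, ← mul_pow, hA2, one_pow]

lemma pow_eq_zeta (p : ℕ) [hp : Fact p.Prime] {x y : PowerSeries (ZMod p)} (hy : y ≠ 0)
    (h : x ^ (p - 1) = y ^ (p - 1)) : ∃ z : ZMod p, x = PowerSeries.C z * y := by
  have hp1 := hp.out.one_lt
  have hpoly : ∏ z : ZMod p, (X - C z) = (X ^ p - X : (ZMod p)[X]) := by
    have hr := FiniteField.roots_X_pow_card_sub_X (ZMod p)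
    rw [ZMod.card] at hr
    have hm : (X ^ p - X : (ZMod p)[X]).Monic :=
      Polynomial.monic_X_pow_sub (by rw [Polynomial.degree_X]; exact_mod_cast hp1)
    have := Polynomial.prod_multiset_X_sub_C_of_monic_of_roots_card_eq hm (by
      rw [hr, FiniteField.X_pow_card_sub_X_natDegree_eq _ hp1, Finset.card_val, Finset.card_univ,
        ZMod.card])
    rw [hr] at this
    exact this
  let F := FractionRing (PowerSeries (ZMod p))
  have hy' : algebraMap (PowerSeries (ZMod p)) F y ≠ 0 := by
    simpa using hy
  set t : F := algebraMap _ F x / algebraMap _ F y with ht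
  have ht1 : t ^ (p - 1) = 1 := by
    rw [ht, div_pow, ← map_pow, ← map_pow, h, div_self]
    rw [map_pow]; exact pow_ne_zero _ hy'
  have ht2 : t ^ p - t = 0 := by
    rw [show t ^ p = t ^ (p - 1) * t by rw [← pow_succ, Nat.sub_add_cancel hp.out.pos], ht1,
      one_mul, sub_self]
  have hX : ∏ z : ZMod p, (t - algebraMap (PowerSeries (ZMod p)) F (PowerSeries.C z)) = 0 := by
    have := congrArg (Polynomial.eval₂ ((algebraMap (PowerSeries (ZMod p)) F).comp
      (PowerSeries.C (R := ZMod p))) t) hpoly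
    rw [Polynomial.eval₂_finsetProd] at this
    simpa [ht2] using this
  obtain ⟨z, _, hz⟩ := Finset.prod_eq_zero_iff.1 hX
  refine ⟨z, ?_⟩
  apply IsFractionRing.injective (PowerSeries (ZMod p)) F
  rw [sub_eq_zero, ht, div_eq_iff hy'] at hz
  rw [hz, map_mul]

/-- Two proportional monomials, with coefficients of bounded degree. -/
lemma pair_bounded (p : ℕ) [hp : Fact p.Prime] {a b : I →₀ ℕ} (D : ℕ)
    (ha : ∑ i ∈ a.support, a i ≤ D) (hb : ∑ i ∈ b.support, b i ≤ D) (hab : a ≠ b)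
    {u v : (ZMod p)[X]} (hu : u ≠ 0) (hv : v ≠ 0)
    (h : (u : PowerSeries (ZMod p)) * mon (ZMod p) a = v * mon (ZMod p) b) :
    Dep (ZMod p) {a, b} (D + 1) := by
  have hp1 : 0 < p - 1 := Nat.sub_pos_of_lt hp.out.one_lt
  obtain ⟨A, hA1, hA2⟩ := mon_A p a
  obtain ⟨B, hB1, hB2⟩ := mon_A p b
  have hA0 : A ≠ 0 := by rintro rfl; simp at hA2
  have hB0 : B ≠ 0 := by rintro rfl; simp at hB2
  -- divide by the gcd
  obtain ⟨g, hg0, u', v', hu', hv', hcop⟩ : ∃ g : (ZMod p)[X], g ≠ 0 ∧ ∃ u' v',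
      u = g * u' ∧ v = g * v' ∧ IsCoprime u' v' := by
    have hg0 : EuclideanDomain.gcd u v ≠ 0 := fun h0 => hu (EuclideanDomain.gcd_eq_zero_iff.1 h0).1
    obtain ⟨u', hu'⟩ := EuclideanDomain.gcd_dvd_left u v
    obtain ⟨v', hv'⟩ := EuclideanDomain.gcd_dvd_right u v
    refine ⟨_, hg0, u', v', hu', hv', EuclideanDomain.gcdA u v, EuclideanDomain.gcdB u v, ?_⟩
    apply mul_left_cancel₀ hg0
    have hab := EuclideanDomain.gcd_eq_gcd_ab u v
    rw [mul_one]
    conv_rhs => rw [hab]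
    conv_rhs => enter [1, 1]; rw [hu']
    conv_rhs => enter [2, 1]; rw [hv']
    ring
  have hcoe : ∀ P R : (ZMod p)[X], ((P * R : (ZMod p)[X]) : PowerSeries (ZMod p)) = P * R :=
    fun P R => Polynomial.coe_mul P R
  have hu0 : u' ≠ 0 := by rintro rfl; simp at hu'; exact hu hu'
  have hv0 : v' ≠ 0 := by rintro rfl; simp at hv'; exact hv hv'
  have h1 : (u' : PowerSeries (ZMod p)) * mon (ZMod p) a = v' * mon (ZMod p) b := by
    have hgc : (g : PowerSeries (ZMod p)) ≠ 0 := by exact_mod_cast hg0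
    apply mul_left_cancel₀ hgc
    rw [hu', hv', hcoe, hcoe] at h
    rw [← mul_assoc, h, mul_assoc]
  have h2 : u' ^ (p - 1) * B = v' ^ (p - 1) * A := by
    apply Polynomial.coe_injective
    rw [hcoe, hcoe, Polynomial.coe_pow, Polynomial.coe_pow]
    have h3 := congrArg (fun x => x ^ (p - 1)) h1
    simp only [mul_pow] at h3
    calc (u' : PowerSeries (ZMod p)) ^ (p - 1) * B
        = (u' : PowerSeries (ZMod p)) ^ (p - 1) * B * (A * mon (ZMod p) a ^ (p - 1)) := by
          rw [hA2, mul_one]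
      _ = ((u' : PowerSeries (ZMod p)) ^ (p - 1) * mon (ZMod p) a ^ (p - 1)) * B * A := by ring
      _ = (v' : PowerSeries (ZMod p)) ^ (p - 1) * A * (B * mon (ZMod p) b ^ (p - 1)) := by
          rw [h3]; ring
      _ = _ := by rw [hB2, mul_one]
  have hdeg : ∀ (w C : (ZMod p)[X]), C ≠ 0 → w ^ (p - 1) ∣ C → C.natDegree ≤ (p - 1) * D →
      w.degree < ((D + 1 : ℕ) : WithBot ℕ) := by
    intro w C hC hd hle
    have h4 := Polynomial.natDegree_le_of_dvd hd hC
    rw [Polynomial.natDegree_pow] at h4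
    have h5 := Nat.le_of_mul_le_mul_left (h4.trans hle) hp1
    refine Polynomial.degree_le_natDegree.trans_lt ?_
    exact_mod_cast Nat.lt_succ_of_le h5
  have hud : u' ^ (p - 1) ∣ A :=
    (hcop.pow (m := p - 1) (n := p - 1)).dvd_of_dvd_mul_left (Dvd.intro _ h2)
  have hvd : v' ^ (p - 1) ∣ B :=
    (hcop.symm.pow (m := p - 1) (n := p - 1)).dvd_of_dvd_mul_left (Dvd.intro _ h2.symm)
  have hud' := hdeg u' A hA0 hud (hA1.trans (Nat.mul_le_mul_left _ ha))
  have hvd' := hdeg v' B hB0 hvd (hB1.trans (Nat.mul_le_mul_left _ hb))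
  classical
  refine ⟨fun d => if d = a then u' else -v', ⟨a, by simp, by simp [hu0]⟩, ?_, ?_⟩
  · intro d _
    dsimp only
    split_ifs
    · exact hud'
    · rw [Polynomial.degree_neg]; exact hvd'
  · rw [Finset.sum_pair hab]
    simp only [if_true, if_neg hab.symm, Polynomial.coe_neg, h1]
    ring

lemma exists_pair (p : ℕ) [hp : Fact p.Prime] {S : Finset (I →₀ ℕ)} (D : ℕ)
    (hD : ∀ d ∈ S, ∑ i ∈ d.support, d i ≤ D) {N : ℕ} (h : Dep (ZMod p) S N) :
    ∃ a ∈ S, ∃ b ∈ S, a ≠ b ∧ Dep (ZMod p) {a, b} (D + 1) := by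
  classical
  have ppow : ∀ {M : Type} [Monoid M] (x : M), x ^ p = x ^ (p - 1) * x := fun x => by
    rw [← pow_succ, Nat.sub_add_cancel hp.out.pos]
  choose B hB1 hB2 using fun d => mon_A p d
  have hB0 : ∀ d, B d ≠ 0 := by
    intro d hd
    have := hB2 d
    simp [hd] at this
  have hm0 : ∀ d, mon (ZMod p) d ≠ 0 := by
    intro d hd
    have := hB2 d
    rw [hd, zero_pow (Nat.sub_pos_of_lt hp.out.one_lt).ne'] at this
    simp at this
  -- minimal relation
  let Q : ℕ → Prop := fun k => ∃ c : (I →₀ ℕ) → (ZMod p)[X], (S.filter fun d => c d ≠ 0).Nonempty ∧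
    (S.filter fun d => c d ≠ 0).card = k ∧
    ∑ d ∈ S, (c d : PowerSeries (ZMod p)) * mon (ZMod p) d = 0
  have hQ : ∃ k, Q k := by
    obtain ⟨c, ⟨d, hd, hne⟩, _, hs⟩ := h
    exact ⟨_, c, ⟨d, by simp [hd, hne]⟩, rfl, hs⟩
  obtain ⟨c, ⟨a, haS⟩, hcard, hs⟩ := Nat.find_spec hQ
  have hmin : ∀ c' : (I →₀ ℕ) → (ZMod p)[X],
      ∑ d ∈ S, (c' d : PowerSeries (ZMod p)) * mon (ZMod p) d = 0 →
      (∀ d ∈ S, c d = 0 → c' d = 0) → c' a = 0 → ∀ d ∈ S, c' d = 0 := by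
    intro c' hc' hsub ha0
    by_contra! hcon
    obtain ⟨d, hd, hne⟩ := hcon
    refine Nat.find_min hQ (m := (S.filter fun d => c' d ≠ 0).card) ?_
      ⟨c', ⟨d, by simp [hd, hne]⟩, rfl, hc'⟩
    rw [← hcard]
    apply Finset.card_lt_card
    rw [Finset.ssubset_iff_of_subset]
    · exact ⟨a, haS, by simp [ha0]⟩
    · intro x hx
      rw [Finset.mem_filter] at hx ⊢
      exact ⟨hx.1, fun h0 => hx.2 (hsub x hx.1 h0)⟩
  rw [Finset.mem_filter] at haS
  obtain ⟨haS, hca⟩ := haS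
  -- a second element of the support
  obtain ⟨b, hbS, hba, hcb⟩ : ∃ b ∈ S, b ≠ a ∧ c b ≠ 0 := by
    by_contra! hcon
    rw [Finset.sum_eq_single a (fun b hb hne => by rw [hcon b hb hne]; simp)
      (fun h => absurd haS h)] at hs
    rcases mul_eq_zero.1 hs with h0 | h0
    · exact hca (by exact_mod_cast h0)
    · exact hm0 a h0
  -- Frobenius
  let E : (I →₀ ℕ) → (ZMod p)[X] := fun d => ∏ e ∈ S.erase d, B e
  have hE : ∀ d ∈ S, B d * E d = ∏ e ∈ S, B e := fun d hd => Finset.mul_prod_erase S B hd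
  have hcoe : ∀ P R : (ZMod p)[X], ((P * R : (ZMod p)[X]) : PowerSeries (ZMod p)) = P * R :=
    fun P R => Polynomial.coe_mul P R
  have hmp : ∀ d, (B d : PowerSeries (ZMod p)) * mon (ZMod p) d ^ p = mon (ZMod p) d := by
    intro d
    rw [ppow, ← mul_assoc, hB2, one_mul]
  have hfrob : ∑ d ∈ S, ((c d ^ p * E d : (ZMod p)[X]) : PowerSeries (ZMod p)) * mon (ZMod p) d
      = 0 := by
    have h1 : (∑ d ∈ S, (c d : PowerSeries (ZMod p)) * mon (ZMod p) d) ^ p = 0 := by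
      rw [hs, zero_pow hp.out.ne_zero]
    rw [cb_pow_p, map_sum] at h1
    simp only [← cb_pow_p] at h1
    have h2 := congrArg (fun x => ((∏ e ∈ S, B e : (ZMod p)[X]) : PowerSeries (ZMod p)) * x) h1
    simp only [mul_zero, Finset.mul_sum] at h2
    rw [← h2]
    refine Finset.sum_congr rfl fun d hd => ?_
    rw [← hE d hd, hcoe, hcoe, Polynomial.coe_pow]
    nth_rewrite 1 [← hmp d]
    ring
  have hzero := hmin (fun d => c d ^ p * E d - c a ^ (p - 1) * E a * c d) (by
      have : ∀ d, (((c d ^ p * E d - c a ^ (p - 1) * E a * c d : (ZMod p)[X])) :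
          PowerSeries (ZMod p)) * mon (ZMod p) d =
          ((c d ^ p * E d : (ZMod p)[X]) : PowerSeries (ZMod p)) * mon (ZMod p) d -
          ((c a ^ (p - 1) * E a : (ZMod p)[X]) : PowerSeries (ZMod p)) *
            ((c d : PowerSeries (ZMod p)) * mon (ZMod p) d) := by
        intro d
        rw [Polynomial.coe_sub, hcoe (c a ^ (p - 1) * E a)]
        ring
      simp only [this]
      rw [Finset.sum_sub_distrib, hfrob, ← Finset.mul_sum, hs]
      simp) (by
      intro d _ h0
      simp [h0, hp.out.ne_zero]) (by
      rw [ppow (c a)]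
      ring) b hbS
  have h3 : c b ^ (p - 1) * B a = c a ^ (p - 1) * B b := by
    have e1 : c b ^ (p - 1) * E b = c a ^ (p - 1) * E a := by
      apply mul_right_cancel₀ hcb
      rw [← sub_eq_zero, ← hzero]
      rw [ppow (c b)]
      ring
    have hE0 : E b ≠ 0 := Finset.prod_ne_zero_iff.2 fun e _ => hB0 e
    apply mul_right_cancel₀ hE0
    calc c b ^ (p - 1) * B a * E b = B a * (c b ^ (p - 1) * E b) := by ring
      _ = c a ^ (p - 1) * (B a * E a) := by rw [e1]; ring
      _ = c a ^ (p - 1) * (B b * E b) := by rw [hE a haS, hE b hbS]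
      _ = _ := by ring
  have h4 : ((c b : PowerSeries (ZMod p)) * mon (ZMod p) b) ^ (p - 1) =
      ((c a : PowerSeries (ZMod p)) * mon (ZMod p) a) ^ (p - 1) := by
    have h3' := congrArg (fun x : (ZMod p)[X] => (x : PowerSeries (ZMod p))) h3
    simp only [hcoe, Polynomial.coe_pow] at h3'
    calc ((c b : PowerSeries (ZMod p)) * mon (ZMod p) b) ^ (p - 1)
        = (c b : PowerSeries (ZMod p)) ^ (p - 1) * mon (ZMod p) b ^ (p - 1) *
          (B a * mon (ZMod p) a ^ (p - 1)) := by rw [hB2, mul_one, mul_pow]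
      _ = ((c b : PowerSeries (ZMod p)) ^ (p - 1) * B a) * mon (ZMod p) b ^ (p - 1) *
          mon (ZMod p) a ^ (p - 1) := by ring
      _ = (c a : PowerSeries (ZMod p)) ^ (p - 1) * mon (ZMod p) a ^ (p - 1) *
          (B b * mon (ZMod p) b ^ (p - 1)) := by rw [h3']; ring
      _ = _ := by rw [hB2, mul_one, mul_pow]
  have hne1 : (c a : PowerSeries (ZMod p)) * mon (ZMod p) a ≠ 0 :=
    mul_ne_zero (by exact_mod_cast hca) (hm0 a)
  have hne2 : (c b : PowerSeries (ZMod p)) * mon (ZMod p) b ≠ 0 :=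
    mul_ne_zero (by exact_mod_cast hcb) (hm0 b)
  obtain ⟨z, hz⟩ := pow_eq_zeta p hne1 h4
  have hz0 : z ≠ 0 := by
    rintro rfl
    apply hne2
    rw [hz]; simp
  refine ⟨a, haS, b, hbS, hba.symm, pair_bounded p D (hD a haS) (hD b hbS) hba.symm
    (u := C z * c a) (v := c b) (mul_ne_zero (by simpa using hz0) hca) hcb ?_⟩
  rw [hz, hcoe, Polynomial.coe_C, mul_assoc]

open Filter Topology

noncomputable def F (r k : ℕ) (x : ℝ) : ℝ := ∑' n : ℕ, (n : ℝ) ^ k * (Nat.centralBinom n : ℝ) ^ r * x ^ n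

noncomputable def rho (r : ℕ) : ℝ := (1 / 4) ^ r

lemma rho_pos (r : ℕ) : 0 < rho r := by unfold rho; positivity

lemma rho_four (r n : ℕ) : (rho r) ^ n * ((4 : ℝ) ^ n) ^ r = 1 := by
  rw [rho, ← pow_mul, ← pow_mul, mul_comm n r, ← mul_pow]
  norm_num

lemma cb_le (n : ℕ) : (Nat.centralBinom n : ℝ) ≤ 4 ^ n := by
  exact_mod_cast Nat.centralBinom_le_four_pow n

lemma summable_F (r k : ℕ) {x : ℝ} (hx : |x| < rho r) :
    Summable fun n : ℕ => ‖(n : ℝ) ^ k * (Nat.centralBinom n : ℝ) ^ r * x ^ n‖ := by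
  have h1 : ‖x / rho r‖ < 1 := by
    rw [norm_div, Real.norm_eq_abs, Real.norm_of_nonneg (rho_pos r).le, div_lt_one (rho_pos r)]
    exact hx
  have h2 := (summable_pow_mul_geometric_of_norm_lt_one k h1).norm
  refine Summable.of_nonneg_of_le (fun _ => norm_nonneg _) (fun n => ?_) h2
  rw [norm_mul, norm_mul, norm_mul, mul_assoc]
  refine mul_le_mul_of_nonneg_left ?_ (norm_nonneg _)
  rw [norm_pow x n, norm_pow (x / rho r) n, norm_div, div_pow, Real.norm_of_nonneg (rho_pos r).le,
    Real.norm_of_nonneg (by positivity : (0 : ℝ) ≤ (Nat.centralBinom n : ℝ) ^ r), mul_comm,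
    div_eq_mul_inv]
  refine mul_le_mul_of_nonneg_left ?_ (by positivity)
  rw [eq_inv_of_mul_eq_one_left ((mul_comm _ _).trans (rho_four r n)) |>.symm]
  exact pow_le_pow_left₀ (by positivity) (cb_le n) r

lemma hasDerivAt_F (r k : ℕ) {x : ℝ} (hx0 : 0 < x) (hx : x < rho r) :
    HasDerivAt (F r k) (F r (k + 1) x / x) x := by
  obtain ⟨y, hxy, hy⟩ := exists_between hx
  have hy0 : 0 < y := hx0.trans hxy
  have key := hasDerivAt_tsum_of_isPreconnected (𝕜 := ℝ) (F := ℝ)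
    (g := fun (n : ℕ) (z : ℝ) => (n : ℝ) ^ k * (Nat.centralBinom n : ℝ) ^ r * z ^ n)
    (g' := fun (n : ℕ) (z : ℝ) => (n : ℝ) ^ k * (Nat.centralBinom n : ℝ) ^ r * (n * z ^ (n - 1)))
    (u := fun n : ℕ => ‖(n : ℝ) ^ (k + 1) * (Nat.centralBinom n : ℝ) ^ r * y ^ n‖ / y)
    (t := Metric.ball 0 y) (y₀ := x) (y := x)
    ((summable_F r (k + 1) (by rwa [abs_of_pos hy0])).div_const y) Metric.isOpen_ball
    (convex_ball 0 y).isPreconnected ?_ ?_ ?_ ?_ ?_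
  · have e : F r (k + 1) x / x = ∑' n : ℕ,
        (n : ℝ) ^ k * (Nat.centralBinom n : ℝ) ^ r * (n * x ^ (n - 1)) := ?_
    · rw [e]
      exact key
    unfold F
    rw [← tsum_div_const]
    refine tsum_congr fun n => ?_
    rcases n with _ | n
    · simp
    · rw [Nat.add_sub_cancel]
      field_simp
      ring
  · intro n z _
    exact (hasDerivAt_pow n z).const_mul _
  · intro n z hz
    rw [mem_ball_zero_iff] at hz
    rcases n with _ | n
    · simp
    · rw [Nat.add_sub_cancel, le_div_iff₀ hy0]
      simp only [norm_mul, norm_pow]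
      rw [Real.norm_of_nonneg hy0.le]
      have : ‖z‖ ^ n ≤ y ^ n := pow_le_pow_left₀ (norm_nonneg _) hz.le n
      calc _ = ‖((n + 1 : ℕ) : ℝ)‖ ^ (k + 1) * ‖(Nat.centralBinom (n + 1) : ℝ)‖ ^ r * (‖z‖ ^ n * y) := by ring
        _ ≤ ‖((n + 1 : ℕ) : ℝ)‖ ^ (k + 1) * ‖(Nat.centralBinom (n + 1) : ℝ)‖ ^ r * (y ^ n * y) := by gcongr
        _ = _ := by ring
  · rw [mem_ball_zero_iff, Real.norm_of_nonneg hx0.le]; exact hxy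
  · exact (summable_F r k (by rwa [abs_of_pos hx0])).of_norm
  · rw [mem_ball_zero_iff, Real.norm_of_nonneg hx0.le]; exact hxy

lemma left_mem (r : ℕ) : ∀ᶠ x in 𝓝[<] rho r, rho r / 2 < x ∧ x < rho r := by
  have h := rho_pos r
  exact Ioo_mem_nhdsLT (by linarith)

lemma F_analytic_step (r k : ℕ) (H : ℝ → ℝ) (hH : AnalyticAt ℝ H (rho r))
    (he : ∀ᶠ x in 𝓝[<] rho r, F r k x = H x) :
    ∃ H' : ℝ → ℝ, AnalyticAt ℝ H' (rho r) ∧ ∀ᶠ x in 𝓝[<] rho r, F r (k + 1) x = H' x := by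
  refine ⟨fun x => x * deriv H x, analyticAt_id.mul hH.deriv, ?_⟩
  have h1 := eventually_eventually_nhdsWithin.2 he
  filter_upwards [h1, left_mem r] with x hx1 hx2
  have hx0 : 0 < x := by have := rho_pos r; linarith [hx2.1]
  rw [IsOpen.nhdsWithin_eq isOpen_Iio (Set.mem_Iio.2 hx2.2)] at hx1
  have h2 : deriv (F r k) x = deriv H x := Filter.EventuallyEq.deriv_eq hx1
  rw [← h2, (hasDerivAt_F r k hx0 hx2.2).deriv]
  field_simp

lemma F_not_analytic (r : ℕ) (H : ℝ → ℝ) (hH : AnalyticAt ℝ H (rho r))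
    (he : ∀ᶠ x in 𝓝[<] rho r, F r 0 x = H x) : False := by
  have hall : ∀ k, ∃ H' : ℝ → ℝ, AnalyticAt ℝ H' (rho r) ∧
      ∀ᶠ x in 𝓝[<] rho r, F r k x = H' x := by
    intro k
    induction k with
    | zero => exact ⟨H, hH, he⟩
    | succ k ih =>
      obtain ⟨H', h1, h2⟩ := ih
      exact F_analytic_step r k H' h1 h2
  obtain ⟨G, hG, hGe⟩ := hall r
  have hlim : Tendsto (F r r) (𝓝[<] rho r) (𝓝 (G (rho r))) :=
    (hG.continuousAt.tendsto.mono_left nhdsWithin_le_nhds).congr' (hGe.mono fun x hx => hx.symm)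
  have hbound : ∀ M : ℕ, (M : ℝ) * (1 / 2) ^ r ≤ G (rho r) := by
    intro M
    have hcont : Tendsto (fun x : ℝ => ∑ n ∈ Finset.range (M + 1),
        (n : ℝ) ^ r * (Nat.centralBinom n : ℝ) ^ r * x ^ n) (𝓝[<] rho r)
        (𝓝 (∑ n ∈ Finset.range (M + 1), (n : ℝ) ^ r * (Nat.centralBinom n : ℝ) ^ r * rho r ^ n)) := by
      have : Continuous (fun x : ℝ => ∑ n ∈ Finset.range (M + 1),
        (n : ℝ) ^ r * (Nat.centralBinom n : ℝ) ^ r * x ^ n) := by fun_prop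
      exact this.continuousAt.tendsto.mono_left nhdsWithin_le_nhds
    have h1 := le_of_tendsto_of_tendsto hcont hlim (by
      filter_upwards [left_mem r] with x hx
      have hx0 : 0 < x := by have := rho_pos r; linarith [hx.1]
      refine Summable.sum_le_tsum _ (fun n _ => by positivity) ?_
      exact (summable_F r r (by rw [abs_of_pos hx0]; exact hx.2)).of_norm)
    refine le_trans ?_ h1
    rw [Finset.sum_range_succ']
    have h2 : ∀ n ∈ Finset.range M, (1 / 2 : ℝ) ^ r ≤
        ((n + 1 : ℕ) : ℝ) ^ r * (Nat.centralBinom (n + 1) : ℝ) ^ r * rho r ^ (n + 1) := by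
      intro n _
      have h3 : (4 : ℝ) ^ (n + 1) ≤ 2 * ((n + 1 : ℕ) : ℝ) * (Nat.centralBinom (n + 1) : ℝ) := by
        exact_mod_cast Nat.four_pow_le_two_mul_self_mul_centralBinom (n + 1) (Nat.succ_pos n)
      have h4 : ((4 : ℝ) ^ (n + 1)) ^ r ≤
          (2 * ((n + 1 : ℕ) : ℝ) * (Nat.centralBinom (n + 1) : ℝ)) ^ r :=
        pow_le_pow_left₀ (by positivity) h3 r
      have h5 := mul_le_mul_of_nonneg_left h4 (pow_nonneg (rho_pos r).le (n + 1))
      rw [rho_four, mul_pow, mul_pow] at h5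
      rw [div_pow, one_pow, div_le_iff₀ (by positivity)]
      linarith
    have h6 := Finset.sum_le_sum h2
    rw [Finset.sum_const, Finset.card_range, nsmul_eq_mul] at h6
    have h7 : 0 ≤ ((0 : ℕ) : ℝ) ^ r * (Nat.centralBinom 0 : ℝ) ^ r * rho r ^ 0 := by positivity
    exact h6.trans (le_add_of_nonneg_right h7)
  obtain ⟨M, hM⟩ := exists_nat_gt (G (rho r) / (1 / 2) ^ r)
  rw [div_lt_iff₀ (by positivity)] at hM
  exact absurd (hbound M) (not_le.2 hM)

lemma one_le_F (r : ℕ) {x : ℝ} (hx0 : 0 ≤ x) (hx : x < rho r) : 1 ≤ F r 0 x := by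
  have := Summable.le_tsum (summable_F r 0 (by rwa [abs_of_nonneg hx0])).of_norm 0
    (fun n _ => by positivity)
  simpa [F] using this

lemma centralBinom_sq_le (n : ℕ) : (Nat.centralBinom n) ^ 2 * (2 * n + 1) ≤ (4 ^ n) ^ 2 := by
  induction n with
  | zero => simp
  | succ n ih =>
    have h := Nat.succ_mul_centralBinom_succ n
    have h1 : (n + 1) ^ 2 * ((n + 1).centralBinom ^ 2 * (2 * (n + 1) + 1)) ≤
        (n + 1) ^ 2 * (4 ^ (n + 1)) ^ 2 := by
      calc (n + 1) ^ 2 * ((n + 1).centralBinom ^ 2 * (2 * (n + 1) + 1))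
          = ((n + 1) * (n + 1).centralBinom) ^ 2 * (2 * (n + 1) + 1) := by ring
        _ = (n.centralBinom ^ 2 * (2 * n + 1)) * (4 * ((2 * n + 1) * (2 * n + 3))) := by
          rw [h]; ring
        _ ≤ (4 ^ n) ^ 2 * (4 * ((2 * n + 2) * (2 * n + 2))) := by
          refine Nat.mul_le_mul ih (Nat.mul_le_mul_left _ ?_)
          nlinarith
        _ = _ := by ring
    exact Nat.le_of_mul_le_mul_left h1 (by positivity)

lemma F_le_log {r : ℕ} (hr : 2 ≤ r) {x : ℝ} (hx0 : rho r / 2 < x) (hx : x < rho r) :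
    F r 0 x ≤ 2 * (-Real.log (1 - x / rho r)) := by
  have hρ := rho_pos r
  have hxp : 0 < x := by linarith
  set y := x / rho r with hy
  have hy0 : 1 / 2 < y := by rw [hy, lt_div_iff₀ hρ]; linarith
  have hy1 : y < 1 := by rw [hy, div_lt_one hρ]; exact hx
  have hs := (Real.hasSum_pow_div_log_of_abs_lt_one (x := y) (by rw [abs_of_pos (by linarith)]; exact hy1)).mul_left 2
  rw [← hs.tsum_eq]
  refine Summable.tsum_le_tsum (fun n => ?_) (summable_F r 0 (by rwa [abs_of_pos hxp])).of_norm hs.summable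
  rw [pow_zero, one_mul]
  have hxy : x = y * rho r := by rw [hy]; field_simp
  have h1 : (Nat.centralBinom n : ℝ) ^ r * rho r ^ n ≤ 1 / (n + 1) := by
    obtain ⟨s, rfl⟩ := Nat.exists_eq_add_of_le hr
    have e1 : (Nat.centralBinom n : ℝ) ^ 2 * (2 * n + 1) ≤ ((4 : ℝ) ^ n) ^ 2 := by
      exact_mod_cast centralBinom_sq_le n
    have e2 : (Nat.centralBinom n : ℝ) ^ s ≤ ((4 : ℝ) ^ n) ^ s :=
      pow_le_pow_left₀ (by positivity) (cb_le n) s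
    have e3 : (Nat.centralBinom n : ℝ) ^ 2 * (n + 1) ≤ ((4 : ℝ) ^ n) ^ 2 := by
      refine le_trans ?_ e1
      refine mul_le_mul_of_nonneg_left ?_ (by positivity)
      have : (0 : ℝ) ≤ n := Nat.cast_nonneg n
      linarith
    rw [le_div_iff₀ (by positivity)]
    calc (Nat.centralBinom n : ℝ) ^ (2 + s) * rho (2 + s) ^ n * (n + 1)
        = ((Nat.centralBinom n : ℝ) ^ 2 * (n + 1)) * (Nat.centralBinom n : ℝ) ^ s * rho (2 + s) ^ n := by ring
      _ ≤ ((4 : ℝ) ^ n) ^ 2 * ((4 : ℝ) ^ n) ^ s * rho (2 + s) ^ n := by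
        refine mul_le_mul_of_nonneg_right ?_ (pow_nonneg hρ.le n)
        exact mul_le_mul e3 e2 (by positivity) (by positivity)
      _ = rho (2 + s) ^ n * ((4 : ℝ) ^ n) ^ (2 + s) := by ring
      _ = 1 := rho_four _ _
  calc (Nat.centralBinom n : ℝ) ^ r * x ^ n = ((Nat.centralBinom n : ℝ) ^ r * rho r ^ n) * y ^ n := by
        rw [hxy, mul_pow]; ring
    _ ≤ 1 / (n + 1) * y ^ n := mul_le_mul_of_nonneg_right h1 (by positivity)
    _ ≤ 1 / (n + 1) * (2 * y ^ (n + 1)) := by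
      refine mul_le_mul_of_nonneg_left ?_ (by positivity)
      rw [pow_succ]
      nlinarith [pow_pos (by linarith : 0 < y) n]
    _ = _ := by ring

lemma F_growth {r : ℕ} (hr : 2 ≤ r) (m : ℕ) :
    Tendsto (fun x => (x - rho r) * F r 0 x ^ m) (𝓝[<] rho r) (𝓝 0) := by
  have hρ := rho_pos r
  have h1 : Tendsto (fun x => (1 - x / rho r)⁻¹) (𝓝[<] rho r) atTop := by
    apply Tendsto.inv_tendsto_nhdsGT_zero
    apply tendsto_nhdsWithin_of_tendsto_nhds_of_eventually_within
    · have : Continuous fun x : ℝ => 1 - x / rho r := by fun_prop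
      have h := this.continuousAt (x := rho r) |>.tendsto
      simp only [div_self hρ.ne', sub_self] at h
      exact h.mono_left nhdsWithin_le_nhds
    · filter_upwards [left_mem r] with x hx
      simp only [Set.mem_Ioi, sub_pos]
      rw [div_lt_one hρ]; exact hx.2
  have h2 : Tendsto (fun x : ℝ => Real.log x ^ m / x) atTop (𝓝 0) :=
    (Real.isLittleO_pow_log_id_atTop (n := m)).tendsto_div_nhds_zero
  have h3 := ((h2.comp h1).const_mul (rho r * 2 ^ m))
  rw [mul_zero] at h3
  apply squeeze_zero_norm' _ h3
  filter_upwards [left_mem r] with x hx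
  have hx0 : 0 < x := by linarith [hx.1]
  have hF := F_le_log hr hx.1 hx.2
  have hF1 := one_le_F r hx0.le hx.2
  have h4 : 0 < 1 - x / rho r := by rw [sub_pos, div_lt_one hρ]; exact hx.2
  have h5 : F r 0 x ^ m ≤ (2 * (-Real.log (1 - x / rho r))) ^ m :=
    pow_le_pow_left₀ (by linarith) hF m
  rw [norm_mul, norm_pow, Real.norm_of_nonneg (by linarith : 0 ≤ F r 0 x), Real.norm_eq_abs,
    abs_of_neg (by linarith [hx.2])]
  simp only [Function.comp, Real.log_inv, div_inv_eq_mul]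
  calc -(x - rho r) * F r 0 x ^ m ≤ -(x - rho r) * (2 * (-Real.log (1 - x / rho r))) ^ m :=
        mul_le_mul_of_nonneg_left h5 (by linarith [hx.2])
    _ = (rho r * (1 - x / rho r)) * (2 * (-Real.log (1 - x / rho r))) ^ m := by
        congr 1; field_simp; ring
    _ = _ := by rw [mul_pow]; ring

lemma core {r : ℕ} (hr : 2 ≤ r) {m : ℕ} (hm : 0 < m) (s t : ℕ) (g h : ℝ → ℝ)
    (hg : AnalyticAt ℝ g (rho r)) (hh : AnalyticAt ℝ h (rho r)) (hg0 : g (rho r) ≠ 0)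
    (hh0 : h (rho r) ≠ 0)
    (he : ∀ᶠ x in 𝓝[<] rho r, (x - rho r) ^ s * g x * F r 0 x ^ m = (x - rho r) ^ t * h x) :
    False := by
  have hgl : Tendsto g (𝓝[<] rho r) (𝓝 (g (rho r))) :=
    hg.continuousAt.tendsto.mono_left nhdsWithin_le_nhds
  have hhl : Tendsto h (𝓝[<] rho r) (𝓝 (h (rho r))) :=
    hh.continuousAt.tendsto.mono_left nhdsWithin_le_nhds
  have hid : Tendsto (fun x => x - rho r) (𝓝[<] rho r) (𝓝 0) := by
    have : Continuous fun x : ℝ => x - rho r := by fun_prop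
    have h := this.continuousAt (x := rho r) |>.tendsto
    simp only [sub_self] at h
    exact h.mono_left nhdsWithin_le_nhds
  have hF1 : ∀ᶠ x in 𝓝[<] rho r, 1 ≤ F r 0 x := by
    filter_upwards [left_mem r] with x hx
    exact one_le_F r (by linarith [rho_pos r, hx.1]) hx.2
  have hne : ∀ᶠ x in 𝓝[<] rho r, x - rho r ≠ 0 := by
    filter_upwards [left_mem r] with x hx
    exact (sub_neg.2 hx.2).ne
  rcases lt_trichotomy s t with hst | hst | hst
  · obtain ⟨k, rfl⟩ := Nat.exists_eq_add_of_lt hst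
    have h1 : ∀ᶠ x in 𝓝[<] rho r, ‖g x‖ ≤ ‖(x - rho r) ^ (k + 1) * h x‖ := by
      filter_upwards [he, hF1, hne] with x hx hx1 hx2
      have : g x * F r 0 x ^ m = (x - rho r) ^ (k + 1) * h x := by
        apply mul_left_cancel₀ (pow_ne_zero s hx2)
        rw [← mul_assoc, hx]; ring
      rw [← this, norm_mul]
      refine le_mul_of_one_le_right (norm_nonneg _) ?_
      rw [norm_pow]
      exact one_le_pow₀ (hx1.trans (Real.le_norm_self _))
    have h2 := ((hid.pow (k + 1)).mul hhl).norm
    have h3 := le_of_tendsto_of_tendsto hgl.norm h2 h1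
    rw [zero_pow (Nat.succ_ne_zero k), zero_mul, norm_zero] at h3
    exact hg0 (norm_le_zero_iff.1 h3)
  · subst hst
    have h1 : ∀ᶠ x in 𝓝[<] rho r, F r 0 x ^ m = h x / g x := by
      filter_upwards [he, hne, hgl.eventually_ne hg0] with x hx hx2 hx3
      rw [eq_div_iff hx3]
      apply mul_left_cancel₀ (pow_ne_zero s hx2)
      rw [← hx]; ring
    have hw : AnalyticAt ℝ (fun x => h x / g x) (rho r) := hh.div hg hg0
    have hwl : Tendsto (fun x => h x / g x) (𝓝[<] rho r) (𝓝 (h (rho r) / g (rho r))) :=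
      hhl.div hgl hg0
    have hw1 : 1 ≤ h (rho r) / g (rho r) := by
      refine ge_of_tendsto hwl ?_
      filter_upwards [h1, hF1] with x hx hx1
      rw [← hx]; exact one_le_pow₀ hx1
    refine F_not_analytic r (fun x => Real.exp (Real.log (h x / g x) / m)) ?_ ?_
    · have := (hw.log (by linarith)).div (analyticAt_const (v := (m : ℝ))) (by positivity)
      exact this.rexp
    · filter_upwards [h1, hF1] with x hx hx1
      rw [← hx, Real.log_pow, mul_div_cancel_left₀ _ (by positivity), Real.exp_log (by linarith)]
  · obtain ⟨k, rfl⟩ := Nat.exists_eq_add_of_lt hst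
    have h1 : ∀ᶠ x in 𝓝[<] rho r,
        (x - rho r) ^ k * g x * ((x - rho r) * F r 0 x ^ m) = h x := by
      filter_upwards [he, hne] with x hx hx2
      apply mul_left_cancel₀ (pow_ne_zero t hx2)
      rw [← hx]; ring
    have h2 := ((hid.pow k).mul hgl).mul (F_growth hr m)
    rw [mul_zero] at h2
    exact hh0 (tendsto_nhds_unique hhl (h2.congr' h1))

/-- `f` converges absolutely at `x` with value `v`. -/
def Ev (x : ℝ) (f : PowerSeries ℝ) (v : ℝ) : Prop :=
  (Summable fun n => ‖PowerSeries.coeff n f * x ^ n‖) ∧ ∑' n, PowerSeries.coeff n f * x ^ n = v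

lemma Ev.mul {x : ℝ} {f g : PowerSeries ℝ} {v w : ℝ} (hf : Ev x f v) (hg : Ev x g w) :
    Ev x (f * g) (v * w) := by
  have key : ∀ n, PowerSeries.coeff n (f * g) * x ^ n =
      ∑ kl ∈ Finset.HasAntidiagonal.antidiagonal n,
        (PowerSeries.coeff kl.1 f * x ^ kl.1) * (PowerSeries.coeff kl.2 g * x ^ kl.2) := by
    intro n
    rw [PowerSeries.coeff_mul, Finset.sum_mul]
    refine Finset.sum_congr rfl fun kl hkl => ?_
    rw [Finset.HasAntidiagonal.mem_antidiagonal] at hkl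
    rw [← hkl, pow_add]; ring
  have h1 := summable_norm_sum_mul_antidiagonal_of_summable_norm
    (f := fun n => PowerSeries.coeff n f * x ^ n) (g := fun n => PowerSeries.coeff n g * x ^ n)
    hf.1 hg.1
  have h2 := tsum_mul_tsum_eq_tsum_sum_antidiagonal_of_summable_norm
    (f := fun n => PowerSeries.coeff n f * x ^ n) (g := fun n => PowerSeries.coeff n g * x ^ n)
    hf.1 hg.1
  refine ⟨h1.congr fun n => by rw [key n], ?_⟩
  rw [hf.2, hg.2] at h2
  rw [h2]
  exact tsum_congr key

lemma Ev_poly (x : ℝ) (P : ℝ[X]) : Ev x (P : PowerSeries ℝ) (P.eval x) := by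
  have h0 : ∀ n ∉ Finset.range (P.natDegree + 1),
      PowerSeries.coeff n (P : PowerSeries ℝ) * x ^ n = 0 := by
    intro n hn
    rw [Polynomial.coeff_coe, Polynomial.coeff_eq_zero_of_natDegree_lt, zero_mul]
    simpa [Nat.lt_succ_iff] using hn
  refine ⟨?_, ?_⟩
  · exact (summable_of_ne_finset_zero (s := Finset.range (P.natDegree + 1)) h0).norm
  · rw [tsum_eq_sum h0, Polynomial.eval_eq_sum_range]
    simp

lemma Ev_one (x : ℝ) : Ev x 1 1 := by
  simpa using Ev_poly x 1

lemma Ev.pow {x : ℝ} {f : PowerSeries ℝ} {v : ℝ} (hf : Ev x f v) (k : ℕ) :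
    Ev x (f ^ k) (v ^ k) := by
  induction k with
  | zero => simpa using Ev_one x
  | succ k ih => rw [pow_succ, pow_succ]; exact ih.mul hf

lemma Ev_prod {ι : Type*} {x : ℝ} (T : Finset ι) (f : ι → PowerSeries ℝ) (v : ι → ℝ)
    (h : ∀ i ∈ T, Ev x (f i) (v i)) : Ev x (∏ i ∈ T, f i) (∏ i ∈ T, v i) := by
  classical
  induction T using Finset.induction_on with
  | empty => simpa using Ev_one x
  | insert a T ha ih =>
    rw [Finset.prod_insert ha, Finset.prod_insert ha]
    exact (h a (by simp)).mul (ih fun i hi => h i (by simp [hi]))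

lemma Ev_cb {x : ℝ} (r : ℕ) (hx : |x| < rho r) : Ev x (cb ℝ r) (F r 0 x) := by
  have h := summable_F r 0 hx
  refine ⟨?_, ?_⟩
  · simpa [cb] using h
  · simp [cb, F]

lemma F_analyticAt (r : ℕ) {x : ℝ} (hx : |x| < rho r) : AnalyticAt ℝ (F r 0) x := by
  obtain ⟨y, hxy, hy⟩ := exists_between hx
  have hy0 : 0 ≤ y := (abs_nonneg x).trans hxy.le
  let c : ℕ → ℝ := fun n => (Nat.centralBinom n : ℝ) ^ r
  let P := FormalMultilinearSeries.ofScalars ℝ c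
  have hrad : ENNReal.ofReal y ≤ P.radius := by
    apply FormalMultilinearSeries.le_radius_of_summable_norm
    have h := summable_F r 0 (x := y) (by rwa [abs_of_nonneg hy0])
    refine h.congr fun n => ?_
    simp [P, c, abs_of_nonneg hy0, max_eq_left hy0]
  have hpos : 0 < P.radius := lt_of_lt_of_le (by
    rw [ENNReal.ofReal_pos]; exact (abs_nonneg x).trans_lt hxy) hrad
  have hb := (P.hasFPowerSeriesOnBall hpos).analyticAt_of_mem (y := x) (by
    rw [Metric.mem_eball, edist_zero_right]
    refine lt_of_lt_of_le ?_ hrad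
    rw [← ofReal_norm]
    exact (ENNReal.ofReal_lt_ofReal_iff ((abs_nonneg x).trans_lt hxy)).2 hxy)
  convert hb using 1
  ext z
  simp only [P, c]
  have := FormalMultilinearSeries.ofScalars_sum_eq (E := ℝ) (fun n => (Nat.centralBinom n : ℝ) ^ r) z
  unfold FormalMultilinearSeries.ofScalarsSum at this
  rw [this]
  simp [F]

lemma rho_lt {r s : ℕ} (h : r < s) : rho s < rho r := by
  unfold rho
  exact pow_lt_pow_right_of_lt_one₀ (by norm_num) (by norm_num) h

lemma no_relation_aux (r : I) {m : ℕ} (hm : 0 < m) (T : Finset I) (hT : ∀ i ∈ T, i < r)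
    (a b : I →₀ ℕ) {A B : ℝ[X]} (hA : A ≠ 0) (hB : B ≠ 0)
    (h : (A : PowerSeries ℝ) * (cb ℝ r.1 ^ m * ∏ i ∈ T, cb ℝ i.1 ^ a i) =
      B * ∏ i ∈ T, cb ℝ i.1 ^ b i) : False := by
  have hρ := rho_pos r.1
  obtain ⟨A', hA', hA0⟩ := Polynomial.exists_eq_pow_rootMultiplicity_mul_and_not_dvd A hA (rho r.1)
  obtain ⟨B', hB', hB0⟩ := Polynomial.exists_eq_pow_rootMultiplicity_mul_and_not_dvd B hB (rho r.1)
  rw [Polynomial.dvd_iff_isRoot] at hA0 hB0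
  have hi : ∀ i ∈ T, |rho r.1| < rho i.1 := fun i hi => by
    rw [abs_of_pos hρ]; exact rho_lt (hT i hi)
  have hpoly : ∀ P : ℝ[X], AnalyticAt ℝ (fun x => P.eval x) (rho r.1) := fun P =>
    (AnalyticOnNhd.eval_polynomial P) _ (Set.mem_univ _)
  have hprod : ∀ e : I →₀ ℕ, AnalyticAt ℝ (fun x => ∏ i ∈ T, F i.1 0 x ^ e i) (rho r.1) :=
    fun e => Finset.analyticAt_fun_prod _ fun i hiT => (F_analyticAt i.1 (hi i hiT)).pow _
  have hprod0 : ∀ e : I →₀ ℕ, ∏ i ∈ T, F i.1 0 (rho r.1) ^ e i ≠ 0 := by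
    intro e
    refine Finset.prod_ne_zero_iff.2 fun i hiT => pow_ne_zero _ ?_
    have := one_le_F i.1 hρ.le (rho_lt (hT i hiT))
    linarith
  refine core r.2 hm (A.rootMultiplicity (rho r.1)) (B.rootMultiplicity (rho r.1))
    (fun x => A'.eval x * ∏ i ∈ T, F i.1 0 x ^ a i) (fun x => B'.eval x * ∏ i ∈ T, F i.1 0 x ^ b i)
    ((hpoly A').mul (hprod a)) ((hpoly B').mul (hprod b))
    (mul_ne_zero hA0 (hprod0 a)) (mul_ne_zero hB0 (hprod0 b)) ?_
  filter_upwards [left_mem r.1] with x hx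
  have hx0 : 0 < x := by linarith [hx.1]
  have hxr : |x| < rho r.1 := by rw [abs_of_pos hx0]; exact hx.2
  have hTx : ∀ e : I →₀ ℕ, Ev x (∏ i ∈ T, cb ℝ i.1 ^ e i) (∏ i ∈ T, F i.1 0 x ^ e i) := fun e =>
    Ev_prod T _ _ fun i hiT => (Ev_cb i.1 (hxr.trans (rho_lt (hT i hiT)))).pow _
  have e1 := (Ev_poly x A).mul (((Ev_cb r.1 hxr).pow m).mul (hTx a))
  have e2 := (Ev_poly x B).mul (hTx b)
  rw [h] at e1
  have e3 := e1.2.symm.trans e2.2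
  have eA : A.eval x = (x - rho r.1) ^ A.rootMultiplicity (rho r.1) * A'.eval x := by
    conv_lhs => rw [hA']
    simp
  have eB : B.eval x = (x - rho r.1) ^ B.rootMultiplicity (rho r.1) * B'.eval x := by
    conv_lhs => rw [hB']
    simp
  rw [eA, eB] at e3
  linear_combination e3

lemma cb_ne_zero (r : ℕ) : cb ℝ r ≠ 0 := by
  intro h0
  have := congrArg (PowerSeries.coeff 0) h0
  simp [cb] at this

lemma no_relation_lt {a b : I →₀ ℕ} {A B : ℝ[X]} (hA : A ≠ 0) (hB : B ≠ 0)
    (h : (A : PowerSeries ℝ) * mon ℝ a = B * mon ℝ b) (r : I) (hr : b r < a r)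
    (hmax : ∀ i, r < i → a i = b i) : False := by
  classical
  let T := a.support ∪ b.support
  have hrT : r ∈ T := by
    simp only [T, Finset.mem_union, Finsupp.mem_support_iff]; left; omega
  have hmon : ∀ e : I →₀ ℕ, e.support ⊆ T → mon ℝ e =
      (cb ℝ r.1 ^ e r * ∏ i ∈ T.filter (· < r), cb ℝ i.1 ^ e i) *
        ∏ i ∈ T.filter (r < ·), cb ℝ i.1 ^ e i := by
    intro e he
    have h1 : mon ℝ e = ∏ i ∈ T, cb ℝ i.1 ^ e i := by
      rw [mon]
      refine Finset.prod_subset he fun i _ hi => ?_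
      rw [Finsupp.notMem_support_iff.1 hi, pow_zero]
    have h2 : T = insert r (T.filter (· < r)) ∪ T.filter (r < ·) := by
      ext i
      simp only [Finset.mem_union, Finset.mem_insert, Finset.mem_filter]
      constructor
      · intro hi
        rcases lt_trichotomy i r with h | h | h
        · exact Or.inl (Or.inr ⟨hi, h⟩)
        · exact Or.inl (Or.inl h)
        · exact Or.inr ⟨hi, h⟩
      · rintro ((rfl | h) | h)
        · exact hrT
        · exact h.1
        · exact h.1
    rw [h1]
    conv_lhs => rw [h2]
    rw [Finset.prod_union, Finset.prod_insert (by simp)]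
    rw [Finset.disjoint_left]
    intro i hi hi'
    simp only [Finset.mem_insert, Finset.mem_filter] at hi hi'
    rcases hi with rfl | hi
    · exact lt_irrefl _ hi'.2
    · exact lt_asymm hi.2 hi'.2
  have hQ : ∏ i ∈ T.filter (r < ·), cb ℝ i.1 ^ a i = ∏ i ∈ T.filter (r < ·), cb ℝ i.1 ^ b i :=
    Finset.prod_congr rfl fun i hi => by rw [hmax i (Finset.mem_filter.1 hi).2]
  rw [hmon a Finset.subset_union_left, hmon b Finset.subset_union_right, hQ] at h
  obtain ⟨k, hk⟩ := Nat.exists_eq_add_of_lt hr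
  refine no_relation_aux r (Nat.succ_pos k) (T.filter (· < r))
    (fun i hi => (Finset.mem_filter.1 hi).2) a b hA hB ?_
  have hQ0 : ∏ i ∈ T.filter (r < ·), cb ℝ i.1 ^ b i ≠ 0 :=
    Finset.prod_ne_zero_iff.2 fun i _ => pow_ne_zero _ (cb_ne_zero _)
  apply mul_right_cancel₀ hQ0
  apply mul_left_cancel₀ (pow_ne_zero (b r) (cb_ne_zero r.1))
  rw [hk] at h
  rw [Nat.succ_eq_add_one]
  linear_combination h

lemma mon_ne_zero (a : I →₀ ℕ) : mon ℝ a ≠ 0 :=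
  Finset.prod_ne_zero_iff.2 fun i _ => pow_ne_zero _ (cb_ne_zero _)

lemma no_dep_pair {a b : I →₀ ℕ} (hab : a ≠ b) (N : ℕ) : ¬ Dep ℝ {a, b} N := by
  classical
  rintro ⟨c, hne, -, hs⟩
  rw [Finset.sum_pair hab] at hs
  have hca : c a ≠ 0 := by
    intro h0
    obtain ⟨d, hd, hdne⟩ := hne
    rw [Finset.mem_insert, Finset.mem_singleton] at hd
    rcases hd with rfl | rfl
    · exact hdne h0
    · rw [h0] at hs
      simp only [Polynomial.coe_zero, zero_mul, zero_add] at hs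
      rcases mul_eq_zero.1 hs with h | h
      · exact hdne (by exact_mod_cast h)
      · exact mon_ne_zero _ h
  have hcb : c b ≠ 0 := by
    intro h0
    rw [h0] at hs
    simp only [Polynomial.coe_zero, zero_mul, add_zero] at hs
    rcases mul_eq_zero.1 hs with h | h
    · exact hca (by exact_mod_cast h)
    · exact mon_ne_zero _ h
  have h : (c a : PowerSeries ℝ) * mon ℝ a = ((-c b : ℝ[X]) : PowerSeries ℝ) * mon ℝ b := by
    rw [Polynomial.coe_neg]
    linear_combination hs
  -- the largest index at which the exponents differ
  let D := (a.support ∪ b.support).filter fun i => a i ≠ b i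
  have hDmem : ∀ i, a i ≠ b i → i ∈ D := by
    intro i hi
    simp only [D, Finset.mem_filter, Finset.mem_union, Finsupp.mem_support_iff]
    refine ⟨?_, hi⟩
    by_contra! hcon
    exact hi (hcon.1.trans hcon.2.symm)
  have hDne : D.Nonempty := by
    obtain ⟨i, hi⟩ := Finsupp.ne_iff.1 hab
    exact ⟨i, hDmem i hi⟩
  have hr := (Finset.mem_filter.1 (D.max'_mem hDne)).2
  have hmax : ∀ i, D.max' hDne < i → a i = b i := by
    intro i hi
    by_contra hcon
    exact absurd (D.le_max' i (hDmem i hcon)) (not_le.2 hi)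
  rcases lt_or_gt_of_ne hr with hlt | hlt
  · exact no_relation_lt (neg_ne_zero.2 hcb) hca h.symm _ hlt fun i hi => (hmax i hi).symm
  · exact no_relation_lt hca (neg_ne_zero.2 hcb) h _ hlt hmax

lemma no_dep (S : Finset (I →₀ ℕ)) (N : ℕ) : ¬ Dep ℂ S N := by
  classical
  intro h
  let D := S.sup fun d => ∑ i ∈ d.support, d i
  have hD : ∀ d ∈ S, ∑ i ∈ d.support, d i ≤ D := fun d hd =>
    Finset.le_sup (f := fun d : I →₀ ℕ => ∑ i ∈ d.support, d i) hd
  have hfin : (⋃ q ∈ S.offDiag, {p : ℕ | ∃ _ : Fact p.Prime, Dep (ZMod p) {q.1, q.2} (D + 1)}).Finite := by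
    refine Set.Finite.biUnion S.offDiag.finite_toSet fun q hq => ?_
    exact dep_real (no_dep_pair (Finset.mem_offDiag.1 hq).2.2 _)
  refine Nat.infinite_setOfPred_prime (hfin.subset ?_)
  intro p hp
  have : Fact p.Prime := ⟨hp⟩
  obtain ⟨a, ha, b, hb, hab, hdep⟩ := exists_pair p D hD (dep_zmod h p)
  simp only [Set.mem_iUnion]
  exact ⟨(a, b), Finset.mem_offDiag.2 ⟨ha, hb, hab⟩, ⟨hp⟩, hdep⟩

end CBP

/-- The family `{f_r : r ≥ 2}`, where
`f_r(z) = ∑_{n≥0} C(2n,n)^r zⁿ`, is algebraically independent over `ℂ(z)`: every finite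
subfamily (indexed by distinct exponents `r ≥ 2`) satisfies no non-trivial polynomial
relation with coefficients in `ℂ(z)`. -/
theorem centralBinomPow_algebraically_independent :
    AlgebraicIndependent (Polynomial ℂ)
      (fun r : {r : ℕ // 2 ≤ r} => centralBinomPow r.1) := by
  rw [algebraicIndependent_iff]
  intro P hP
  by_contra hne
  obtain ⟨S, N, h⟩ := CBP.exists_dep hne hP
  exact CBP.no_dep S N h
end

section
/- The power series f_1(z) = Σ_{n≥0} (4n)!/((2n)!·n!^2) · z^n and f_2(z) = Σ_{n≥0} (Σ_{k=0}^{n} C(n,k)^6) · z^n are algebraically independent over ℚ(z). -/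
/-- `f₁(z) = ∑_{n≥0} (4n)!/((2n)!·n!²) zⁿ`. -/
noncomputable def ratioSeries : PowerSeries ℚ :=
  PowerSeries.mk fun n =>
    (Nat.factorial (4 * n) : ℚ) / ((Nat.factorial (2 * n) : ℚ) * (Nat.factorial n : ℚ) ^ 2)

/-- `f₂(z) = ∑_{n≥0} (∑_{k=0}^n C(n,k)^6) zⁿ`. -/
noncomputable def franelSixSeries : PowerSeries ℚ :=
  PowerSeries.mk fun n => ∑ k ∈ Finset.range (n + 1), (n.choose k : ℚ) ^ 6

open Polynomial in
lemma split_classes {ι : Type} [DecidableEq ι] (p : ℕ) [Fact p.Prime]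
    (h : ι → PowerSeries (ZMod p)) (B : ι → Polynomial (ZMod p))
    (hB : ∀ i, B i ≠ 0) (hh : ∀ i, h i = (B i : PowerSeries (ZMod p)) * h i ^ p) (w : ι → ℕ) :
    ∀ (n : ℕ) (S : Finset ι), S.card = n →
      (∀ i ∈ S, ∀ j ∈ S, (B i).natDegree ≡ (B j).natDegree [MOD (p-1)] → w i = w j) →
      ∀ c : ι → Polynomial (ZMod p),
      ∑ i ∈ S, (c i : PowerSeries (ZMod p)) * h i = 0 →
      ∀ t, ∑ i ∈ S with w i = t, (c i : PowerSeries (ZMod p)) * h i = 0 := by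
  intro n
  induction n with
  | zero =>
    intro S hS hw c hc t
    rw [Finset.card_eq_zero] at hS
    simp [hS]
  | succ n ih =>
    intro S hS hw c hc t
    by_cases hA : ∃ e : ι → Polynomial (ZMod p), ∃ t0, ∃ j ∈ S, w j = t0 ∧ e j ≠ 0 ∧
        ∑ i ∈ S with w i = t0, (e i : PowerSeries (ZMod p)) * h i = 0
    · obtain ⟨e, t0, j, hjS, hjt, hej, he⟩ := hA
      set c' : ι → Polynomial (ZMod p) :=
        fun i => e j * c i - c j * (if w i = t0 then e i else 0) with hc'
      have hc'j : c' j = 0 := by simp [hc', hjt]; ring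
      have hE : ∀ t, ∑ i ∈ S with w i = t,
          (((if w i = t0 then e i else 0 : Polynomial (ZMod p)) : PowerSeries (ZMod p)) * h i) = 0 := by
        intro t
        by_cases ht : t = t0
        · subst ht
          rw [← he]
          apply Finset.sum_congr rfl
          intro i hi
          rw [if_pos (Finset.mem_filter.1 hi).2]
        · apply Finset.sum_eq_zero
          intro i hi
          rw [if_neg (by rw [(Finset.mem_filter.1 hi).2]; exact ht)]
          simp
      have hE' : ∑ i ∈ S,
          (((if w i = t0 then e i else 0 : Polynomial (ZMod p)) : PowerSeries (ZMod p)) * h i) = 0 := by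
        rw [← he, Finset.sum_filter]
        apply Finset.sum_congr rfl
        intro i hi
        split_ifs <;> simp
      have key : ∀ T : Finset ι, ∑ i ∈ T, (c' i : PowerSeries (ZMod p)) * h i =
          (e j : PowerSeries (ZMod p)) * ∑ i ∈ T, (c i : PowerSeries (ZMod p)) * h i
          - (c j : PowerSeries (ZMod p)) * ∑ i ∈ T,
          (((if w i = t0 then e i else 0 : Polynomial (ZMod p)) : PowerSeries (ZMod p)) * h i) := by
        intro T
        rw [Finset.mul_sum, Finset.mul_sum, ← Finset.sum_sub_distrib]
        apply Finset.sum_congr rfl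
        intro i _
        simp only [hc', Polynomial.coe_sub, Polynomial.coe_mul]
        ring
      have h1 := ih (S.erase j) (by rw [Finset.card_erase_of_mem hjS]; omega)
        (fun a ha b hb => hw a (Finset.mem_of_mem_erase ha) b (Finset.mem_of_mem_erase hb)) c'
        (by
          rw [Finset.sum_erase _ (by rw [hc'j]; simp), key, hc, hE']; simp) t
      rw [Finset.filter_erase, Finset.sum_erase _ (by rw [hc'j]; simp), key, hE] at h1
      simp only [mul_zero, sub_zero, mul_eq_zero] at h1
      rcases h1 with h1 | h1
      · exact absurd (by simpa using h1) hej
      · exact h1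
    · push Not at hA
      by_cases hz : ∃ i0 ∈ S, c i0 ≠ 0
      swap
      · push Not at hz
        apply Finset.sum_eq_zero
        intro i hi
        rw [hz i (Finset.mem_filter.1 hi).1]; simp
      obtain ⟨i0, hi0, hci0⟩ := hz
      set Bh : ι → Polynomial (ZMod p) := fun i => ∏ j ∈ S.erase i, B j with hBh
      set C : Polynomial (ZMod p) := ∏ j ∈ S, B j with hC
      have hBC : ∀ i ∈ S, B i * Bh i = C := fun i hi => Finset.mul_prod_erase S B hi
      have hC0 : C ≠ 0 := Finset.prod_ne_zero_iff.2 (fun i _ => hB i)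
      have hfrob : ∑ i ∈ S, ((c i ^ p * Bh i : Polynomial (ZMod p)) : PowerSeries (ZMod p)) * h i = 0 := by
        have h2 : (∑ i ∈ S, (c i : PowerSeries (ZMod p)) * h i) ^ p = 0 := by
          rw [hc, zero_pow (Fact.out : p.Prime).ne_zero]
        have : CharP (PowerSeries (ZMod p)) p := by
          refine charP_of_injective_ringHom (f := (PowerSeries.C : ZMod p →+* _)) PowerSeries.C_injective p
        rw [sum_pow_char] at h2
        have h3 : (C : PowerSeries (ZMod p)) * ∑ i ∈ S, ((c i : PowerSeries (ZMod p)) * h i) ^ p = 0 := by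
          rw [h2, mul_zero]
        rw [← h3, Finset.mul_sum]
        apply Finset.sum_congr rfl
        intro i hi
        rw [← hBC i hi, Polynomial.coe_mul, Polynomial.coe_mul, Polynomial.coe_pow, mul_pow]
        conv_lhs => rw [hh i]
        ring
      set d : ι → Polynomial (ZMod p) :=
        fun i => c i0 * (c i ^ p * Bh i) - (c i0 ^ p * Bh i0) * c i with hd
      have hdi0 : d i0 = 0 := by simp only [hd]; ring
      have hdsum : ∑ i ∈ S, (d i : PowerSeries (ZMod p)) * h i = 0 := by
        have : ∑ i ∈ S, (d i : PowerSeries (ZMod p)) * h i =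
          (c i0 : PowerSeries (ZMod p)) * ∑ i ∈ S, ((c i ^ p * Bh i : Polynomial (ZMod p)) : PowerSeries (ZMod p)) * h i
          - ((c i0 ^ p * Bh i0 : Polynomial (ZMod p)) : PowerSeries (ZMod p)) * ∑ i ∈ S, (c i : PowerSeries (ZMod p)) * h i := by
          rw [Finset.mul_sum, Finset.mul_sum, ← Finset.sum_sub_distrib]
          apply Finset.sum_congr rfl
          intro i _
          simp only [hd, Polynomial.coe_sub, Polynomial.coe_mul]
          ring
        rw [this, hfrob, hc]; simp
      have hd0 : ∀ i ∈ S, d i = 0 := by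
        intro i hi
        by_contra hne
        refine hA d (w i) i hi rfl hne ?_
        have h1 := ih (S.erase i0) (by rw [Finset.card_erase_of_mem hi0]; omega)
          (fun a ha b hb => hw a (Finset.mem_of_mem_erase ha) b (Finset.mem_of_mem_erase hb)) d
          (by rw [Finset.sum_erase _ (by rw [hdi0]; simp), hdsum]) (w i)
        rwa [Finset.filter_erase, Finset.sum_erase _ (by rw [hdi0]; simp)] at h1
      have hcl : ∀ i ∈ S, c i ≠ 0 → w i = w i0 := by
        intro i hi hci
        apply hw i hi i0 hi0
        have h1 := hd0 i hi
        simp only [hd] at h1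
        obtain ⟨q, hq⟩ : ∃ q, p = q + 1 := ⟨p - 1, by have := (Fact.out : p.Prime).pos; omega⟩
        have h2 : c i ^ q * B i0 = c i0 ^ q * B i := by
          have hk : (C * c i * c i0) * (c i ^ q * B i0 - c i0 ^ q * B i) = 0 := by
            have := congrArg (fun x => x * B i * B i0) h1
            simp only [zero_mul] at this
            rw [← this]
            have e1 := hBC i hi
            have e2 := hBC i0 hi0
            have hp : ∀ x : Polynomial (ZMod p), x ^ p = x ^ q * x := fun x => by
              conv_lhs => rw [show x ^ p = x ^ (q+1) from by rw [← hq]]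
              rw [pow_succ]
            rw [hp, hp]
            linear_combination (-(c i * c i0 * c i ^ q * B i0)) * e1 + (c i * c i0 * c i0 ^ q * B i) * e2
          rcases mul_eq_zero.1 hk with hk | hk
          · exact absurd hk (mul_ne_zero (mul_ne_zero hC0 hci) hci0)
          · exact sub_eq_zero.1 hk
        have h3 := congrArg Polynomial.natDegree h2
        rw [Polynomial.natDegree_mul (pow_ne_zero _ hci) (hB _),
          Polynomial.natDegree_mul (pow_ne_zero _ hci0) (hB _),
          Polynomial.natDegree_pow, Polynomial.natDegree_pow] at h3
        have hq1 : p - 1 = q := by omega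
        rw [hq1]
        have h4 : (q * (c i).natDegree + (B i0).natDegree) % q
          = (q * (c i0).natDegree + (B i).natDegree) % q := by rw [h3]
        rw [Nat.mul_add_mod, Nat.mul_add_mod] at h4
        exact h4.symm
      by_cases ht : t = w i0
      · rw [← hc, Finset.sum_filter]
        apply Finset.sum_congr rfl
        intro i hi
        split_ifs with hwi
        · rfl
        · have : c i = 0 := by
            by_contra hne
            exact hwi ((hcl i hi hne).trans ht.symm)
          rw [this]; simp
      · apply Finset.sum_eq_zero
        intro i hi
        have hi' := Finset.mem_filter.1 hi
        have : c i = 0 := by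
          by_contra hne
          exact ht (hi'.2.symm.trans (hcl i hi'.1 hne))
        rw [this]; simp

def seqOne (n : ℕ) : ℕ := (2 * n).centralBinom * n.centralBinom
def seqTwo (n : ℕ) : ℕ := ∑ k ∈ Finset.range (n + 1), n.choose k ^ 6

noncomputable def truncPoly (a : ℕ → ℕ) (p : ℕ) : Polynomial (ZMod p) :=
  ∑ r ∈ Finset.range p, Polynomial.monomial r (a r : ZMod p)

lemma truncPoly_coeff (a : ℕ → ℕ) (p n : ℕ) :
    (truncPoly a p).coeff n = if n < p then (a n : ZMod p) else 0 := by
  simp [truncPoly, Polynomial.finsetSum_coeff, Polynomial.coeff_monomial]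

lemma truncPoly_natDegree (a : ℕ → ℕ) (p D : ℕ) (hD : D < p) (h0 : (a D : ZMod p) ≠ 0)
    (h1 : ∀ n, D < n → n < p → (a n : ZMod p) = 0) : (truncPoly a p).natDegree = D := by
  apply le_antisymm
  · rw [Polynomial.natDegree_le_iff_coeff_eq_zero]
    intro n hn
    rw [truncPoly_coeff]
    split_ifs with h
    · exact h1 n hn h
    · rfl
  · apply Polynomial.le_natDegree_of_ne_zero
    rwa [truncPoly_coeff, if_pos hD]

noncomputable def modSeries (a : ℕ → ℕ) (p : ℕ) : PowerSeries (ZMod p) :=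
  PowerSeries.mk fun n => (a n : ZMod p)

lemma series_pow_p (p : ℕ) [Fact p.Prime] (g : PowerSeries (ZMod p)) :
    g ^ p = PowerSeries.expand p (Fact.out : p.Prime).ne_zero g := by
  have h := MvPowerSeries.map_frobenius_expand p (Fact.out : p.Prime).ne_zero (f := (g : MvPowerSeries Unit (ZMod p)))
  rw [ZMod.frobenius_zmod] at h
  rw [PowerSeries.expand]
  refine h.symm.trans ?_
  ext
  simp

lemma lucas_series (a : ℕ → ℕ) (p : ℕ) [Fact p.Prime]
    (hl : ∀ n r, r < p → (a (p * n + r) : ZMod p) = a n * a r) :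
    modSeries a p = (truncPoly a p : PowerSeries (ZMod p)) * modSeries a p ^ p := by
  have hp : 0 < p := (Fact.out : p.Prime).pos
  rw [series_pow_p]
  ext N
  have : ((truncPoly a p : Polynomial (ZMod p)) : PowerSeries (ZMod p)) =
      ∑ r ∈ Finset.range p, PowerSeries.C (a r : ZMod p) * PowerSeries.X ^ r := by
    ext n
    rw [Polynomial.coeff_coe, truncPoly_coeff, map_sum]
    simp only [PowerSeries.coeff_C_mul, PowerSeries.coeff_X_pow]
    simp
  rw [this, Finset.sum_mul, map_sum, Finset.sum_eq_single (N % p)]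
  · rw [mul_assoc, PowerSeries.coeff_C_mul, PowerSeries.coeff_X_pow_mul', if_pos (Nat.mod_le _ _)]
    have h2 : N - N % p = p * (N / p) := by have := Nat.div_add_mod N p; omega
    rw [h2, PowerSeries.coeff_expand_mul]
    simp only [modSeries, PowerSeries.coeff_mk]
    rw [mul_comm, ← hl _ _ (Nat.mod_lt _ hp), Nat.div_add_mod]
  · intro r hr hne
    rw [Finset.mem_range] at hr
    rw [mul_assoc, PowerSeries.coeff_C_mul, PowerSeries.coeff_X_pow_mul']
    split_ifs with hle
    · rw [PowerSeries.coeff_expand_of_not_dvd, mul_zero]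
      rintro ⟨q, hq⟩
      apply hne
      have : N = p * q + r := by omega
      rw [this, Nat.mul_add_mod, Nat.mod_eq_of_lt hr]
    · rw [mul_zero]
  · intro h
    exact absurd (Finset.mem_range.2 (Nat.mod_lt _ hp)) h

lemma lucas_cast (p : ℕ) [Fact p.Prime] (n k r s : ℕ) (hr : r < p) (hs : s < p) :
    ((p * n + r).choose (p * k + s) : ZMod p) = n.choose k * r.choose s := by
  have hp : 0 < p := (Fact.out : p.Prime).pos
  have h := Choose.choose_modEq_choose_mod_mul_choose_div_nat (n := p * n + r) (k := p * k + s) (p := p)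
  rw [← ZMod.natCast_eq_natCast_iff] at h
  rw [h, Nat.mul_add_mod, Nat.mul_add_mod, Nat.mul_add_div hp, Nat.mul_add_div hp,
    Nat.mod_eq_of_lt hr, Nat.mod_eq_of_lt hs, Nat.div_eq_of_lt hr, Nat.div_eq_of_lt hs]
  push_cast
  simp [mul_comm]

lemma centralBinom_zero (p : ℕ) [Fact p.Prime] (n r : ℕ) (hr : r < p) (h : p ≤ 2 * r) :
    ((p * n + r).centralBinom : ZMod p) = 0 := by
  rw [Nat.centralBinom, show 2 * (p * n + r) = p * (2 * n + 1) + (2 * r - p) by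
    have : p * (2 * n + 1) = 2 * (p * n) + p := by ring
    omega, lucas_cast p _ _ _ _ (by omega) hr, Nat.choose_eq_zero_of_lt (show 2 * r - p < r by omega)]
  simp

lemma centralBinom_zero' (p : ℕ) [Fact p.Prime] (r : ℕ) (hr : r < p) (h : p ≤ 2 * r) :
    (r.centralBinom : ZMod p) = 0 := by
  simpa using centralBinom_zero p 0 r hr h

lemma centralBinom_lucas (p : ℕ) [Fact p.Prime] (n r : ℕ) (hr : r < p) :
    ((p * n + r).centralBinom : ZMod p) = n.centralBinom * r.centralBinom := by
  by_cases h : p ≤ 2 * r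
  · rw [centralBinom_zero p n r hr h, centralBinom_zero' p r hr h, mul_zero]
  · rw [Nat.centralBinom, show 2 * (p * n + r) = p * (2 * n) + 2 * r by ring,
      lucas_cast p _ _ _ _ (by omega) hr]
    rfl

lemma seqOne_lucas (p : ℕ) [Fact p.Prime] (n r : ℕ) (hr : r < p) :
    (seqOne (p * n + r) : ZMod p) = seqOne n * seqOne r := by
  simp only [seqOne]
  push_cast
  rw [centralBinom_lucas p n r hr]
  by_cases h : p ≤ 2 * r
  · rw [centralBinom_zero' p r hr h]; ring
  · rw [show 2 * (p * n + r) = p * (2 * n) + 2 * r by ring, centralBinom_lucas p _ _ (by omega)]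
    ring

lemma sum_range_block {M : Type*} [AddCommMonoid M] (f : ℕ → M) (p m : ℕ) :
    ∑ k ∈ Finset.range (p * m), f k =
      ∑ i ∈ Finset.range m, ∑ s ∈ Finset.range p, f (p * i + s) := by
  induction m with
  | zero => simp
  | succ m ih => rw [Nat.mul_succ, Finset.sum_range_add, ih, Finset.sum_range_succ]

lemma seqTwo_ext (n m : ℕ) (h : n < m) : seqTwo n = ∑ k ∈ Finset.range m, n.choose k ^ 6 := by
  rw [seqTwo]
  apply Finset.sum_subset
  · intro x; simp only [Finset.mem_range]; omega
  · intro x _ hx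
    simp only [Finset.mem_range] at hx
    rw [Nat.choose_eq_zero_of_lt (by omega)]; simp

lemma seqTwo_lucas (p : ℕ) [Fact p.Prime] (n r : ℕ) (hr : r < p) :
    (seqTwo (p * n + r) : ZMod p) = seqTwo n * seqTwo r := by
  rw [seqTwo_ext (p * n + r) (p * (n + 1)) (by rw [mul_add]; omega), sum_range_block,
    seqTwo_ext r p hr, seqTwo]
  push_cast
  rw [Finset.sum_mul_sum]
  apply Finset.sum_congr rfl
  intro i _
  apply Finset.sum_congr rfl
  intro s hs
  rw [lucas_cast p _ _ _ _ hr (Finset.mem_range.1 hs), mul_pow]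

lemma centralBinom_ne (p : ℕ) [Fact p.Prime] (r : ℕ) (h : 2 * r < p) :
    (r.centralBinom : ZMod p) ≠ 0 := by
  rw [Ne, ZMod.natCast_eq_zero_iff, Nat.centralBinom]
  intro hd
  have h1 : p ∣ (2 * r).factorial := by
    rw [← Nat.choose_mul_factorial_mul_factorial (show r ≤ 2 * r by omega), mul_assoc]
    exact Dvd.dvd.mul_right hd _
  rw [(Fact.out : p.Prime).dvd_factorial] at h1
  omega

lemma degOne (p : ℕ) [Fact p.Prime] : (truncPoly seqOne p).natDegree = p / 4 ∨ p = 2 := by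
  by_cases h2 : p = 2
  · exact Or.inr h2
  left
  have hp := (Fact.out : p.Prime)
  have hodd := hp.eq_two_or_odd.resolve_left h2
  have hp1 := hp.pos
  apply truncPoly_natDegree
  · omega
  · simp only [seqOne]
    push_cast
    exact mul_ne_zero (centralBinom_ne p _ (by omega)) (centralBinom_ne p _ (by omega))
  · intro n hn hnp
    simp only [seqOne]
    push_cast
    by_cases h : p ≤ 2 * n
    · rw [centralBinom_zero' p n hnp h, mul_zero]
    · rw [centralBinom_zero' p (2 * n) (by omega) (by omega), zero_mul]

noncomputable def risePoly (p j : ℕ) : Polynomial (ZMod p) :=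
  ∏ i ∈ Finset.range j, (Polynomial.X + Polynomial.C ((i : ZMod p) + 1))

lemma risePoly_eval (p j : ℕ) (x : ZMod p) :
    (risePoly p j).eval x = ∏ i ∈ Finset.range j, (x + ((i : ZMod p) + 1)) := by
  simp [risePoly, Polynomial.eval_prod]

lemma risePoly_step (p j : ℕ) (x : ZMod p) :
    (risePoly p j).eval (x + 1) * (x + 1) = (risePoly p j).eval x * (x + 1 + j) := by
  have h1 := Finset.prod_range_succ (fun i : ℕ => (x + ((i : ZMod p) + 1))) j
  have h2 := Finset.prod_range_succ' (fun i : ℕ => (x + ((i : ZMod p) + 1))) j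
  rw [h1] at h2
  rw [risePoly_eval, risePoly_eval]
  push_cast at h2
  rw [zero_add] at h2
  rw [show x + 1 + (j : ZMod p) = x + (j + 1) by ring, h2]
  congr 1
  apply Finset.prod_congr rfl
  intro i _
  ring

lemma risePoly_zero (p j : ℕ) : (risePoly p j).eval 0 = (j.factorial : ZMod p) := by
  rw [risePoly_eval, ← Finset.prod_range_add_one_eq_factorial]
  push_cast
  simp

lemma choose_rise (p j : ℕ) [Fact p.Prime] (hj : j < p) (k : ℕ) (hk : k < p) :
    ((p - 1 - j).choose k : ZMod p) * j.factorial = (-1) ^ k * (risePoly p j).eval (k : ZMod p) := by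
  induction k with
  | zero => simp [risePoly_zero]
  | succ k ih =>
    have ih := ih (by omega)
    have hne : ((k : ZMod p) + 1) ≠ 0 := by
      have : (((k + 1 : ℕ)) : ZMod p) ≠ 0 := by
        rw [Ne, ZMod.natCast_eq_zero_iff]
        exact Nat.not_dvd_of_pos_of_lt (by omega) hk
      simpa using this
    have h1 : ((p - 1 - j).choose (k + 1) : ZMod p) * (k + 1) =
        (p - 1 - j).choose k * (-(1 + j + k)) := by
      have h := Nat.choose_succ_right_eq (p - 1 - j) k
      by_cases hkn : k ≤ p - 1 - j
      · have h' := congrArg (Nat.cast : ℕ → ZMod p) h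
        push_cast at h'
        rw [h']
        congr 1
        have : (((p - 1 - j - k) + (1 + j + k) : ℕ) : ZMod p) = 0 := by
          rw [show (p - 1 - j - k) + (1 + j + k) = p by omega]; simp
        push_cast at this
        linear_combination this
      · rw [Nat.choose_eq_zero_of_lt (by omega), Nat.choose_eq_zero_of_lt (by omega)]
        simp
    apply mul_right_cancel₀ hne
    have h2 := risePoly_step p j (k : ZMod p)
    push_cast
    rw [pow_succ]
    linear_combination (j.factorial : ZMod p) * h1 - (1 + j + k) * ih + (-1) ^ k * h2

lemma sum_range_zmod (p : ℕ) [Fact p.Prime] (f : ZMod p → ZMod p) :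
    ∑ k ∈ Finset.range p, f k = ∑ x : ZMod p, f x := by
  apply Finset.sum_nbij (fun k : ℕ => (k : ZMod p))
  · intro a _; simp
  · intro a ha b hb h
    simp only [Finset.coe_range, Set.mem_Iio] at ha hb
    simp only [ZMod.natCast_eq_natCast_iff', Nat.mod_eq_of_lt ha, Nat.mod_eq_of_lt hb] at h
    exact h
  · intro x _
    exact ⟨x.val, by simpa using ZMod.val_lt x, by simp⟩
  · intro a _; rfl

lemma seqTwo_eq_sum (p j : ℕ) [Fact p.Prime] (hj : j < p) :
    (seqTwo (p - 1 - j) : ZMod p) * (j.factorial : ZMod p) ^ 6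
      = ∑ x : ZMod p, (risePoly p j ^ 6).eval x := by
  rw [← sum_range_zmod, seqTwo_ext (p - 1 - j) p (by omega)]
  push_cast
  rw [Finset.sum_mul]
  apply Finset.sum_congr rfl
  intro k hk
  rw [← mul_pow, choose_rise p j hj k (Finset.mem_range.1 hk), mul_pow, ← pow_mul,
    Even.neg_one_pow ⟨k * 3, by ring⟩, one_mul, Polynomial.eval_pow]

lemma sum_eval (p : ℕ) [Fact p.Prime] (hp : 3 < p) (F : Polynomial (ZMod p))
    (hF : F.natDegree < p + 2) : ∑ x : ZMod p, F.eval x = - F.coeff (p - 1) := by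
  simp_rw [Polynomial.eval_eq_sum_range' hF]
  rw [Finset.sum_comm]
  simp_rw [← Finset.mul_sum]
  have hs : ∀ i, i < p - 1 → ∑ x : ZMod p, x ^ i = 0 := by
    intro i hi
    apply FiniteField.sum_pow_lt_card_sub_one
    rwa [ZMod.card]
  have hq : p + 2 = (p - 1) + 1 + 1 + 1 := by omega
  rw [hq, Finset.sum_range_succ, Finset.sum_range_succ, Finset.sum_range_succ,
    Finset.sum_eq_zero (fun i hi => by rw [hs i (Finset.mem_range.1 hi), mul_zero])]
  have e1 : ∑ x : ZMod p, x ^ (p - 1) = -1 := by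
    have : ∀ x : ZMod p, x ^ (p - 1) = 1 - (if x = 0 then 1 else 0) := by
      intro x
      split_ifs with h
      · rw [h, zero_pow (by omega)]; simp
      · rw [ZMod.pow_card_sub_one_eq_one h]; simp
    simp [this]
  have e2 : ∑ x : ZMod p, x ^ (p - 1 + 1) = 0 := by
    rw [show p - 1 + 1 = p by omega]
    simp_rw [ZMod.pow_card]
    simpa using hs 1 (by omega)
  have e3 : ∑ x : ZMod p, x ^ (p - 1 + 1 + 1) = 0 := by
    rw [show p - 1 + 1 + 1 = p + 1 by omega]
    simp_rw [pow_succ, ZMod.pow_card]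
    simpa [pow_two] using hs 2 (by omega)
  rw [e1, e2, e3]
  simp

open Polynomial in
lemma risePoly_top (p j : ℕ) [Fact p.Prime] : ∃ T : Polynomial (ZMod p), T.degree < (6 * j : ℕ) ∧
    X ^ 2 * (C 2 * risePoly p j ^ 6) = X ^ (6 * j) * (C 2 * X ^ 2 + C (6 * (j : ZMod p) * (j + 1)) * X
      + C ((j : ZMod p) * (j + 1) * (9 * j ^ 2 + 7 * j - 1))) + T := by
  induction j with
  | zero => exact ⟨0, by simp, by simp [risePoly]⟩
  | succ j ih =>
    obtain ⟨T, hT, h⟩ := ih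
    rw [risePoly, Finset.prod_range_succ, ← risePoly, mul_pow]
    set c : ZMod p := (j : ZMod p) + 1 with hc
    set E : ZMod p := (j : ZMod p) * (j + 1) * (9 * j ^ 2 + 7 * j - 1) with hE
    set D : ZMod p := 6 * (j : ZMod p) * (j + 1) with hD
    refine ⟨X ^ (6 * j) * (C (2 * 20 * c ^ 3 + D * 15 * c ^ 2 + E * 6 * c) * X ^ 5
      + C (2 * 15 * c ^ 4 + D * 20 * c ^ 3 + E * 15 * c ^ 2) * X ^ 4
      + C (2 * 6 * c ^ 5 + D * 15 * c ^ 4 + E * 20 * c ^ 3) * X ^ 3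
      + C (2 * c ^ 6 + D * 6 * c ^ 5 + E * 15 * c ^ 4) * X ^ 2
      + C (D * c ^ 6 + E * 6 * c ^ 5) * X + C (E * c ^ 6)) + T * (X + C c) ^ 6, ?_, ?_⟩
    · refine lt_of_le_of_lt (degree_add_le _ _) (max_lt ?_ ?_)
      · rw [degree_mul, degree_X_pow, Nat.mul_succ, Nat.cast_add]
        have : ∀ x : WithBot ℕ, x < (6 : ℕ) → ((6 * j : ℕ) : WithBot ℕ) + x < ((6 * j : ℕ) : WithBot ℕ) + (6 : ℕ) :=
          fun x hx => WithBot.add_lt_add_left (WithBot.natCast_ne_bot _) hx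
        apply this
        refine lt_of_le_of_lt (b := ((5 : ℕ) : WithBot ℕ)) ?_ (by norm_num)
        compute_degree
        norm_num
      · rw [degree_mul, degree_pow, degree_X_add_C, Nat.mul_succ, Nat.cast_add]
        exact WithBot.add_lt_add_right (WithBot.natCast_ne_bot 6) hT |>.trans_eq' (by norm_num)
    · have : X ^ 2 * (C 2 * (risePoly p j ^ 6 * (X + C c) ^ 6)) =
        (X ^ 2 * (C 2 * risePoly p j ^ 6)) * (X + C c) ^ 6 := by ring
      rw [this, h]
      have hD' : (6 * ((j + 1 : ℕ) : ZMod p) * (((j + 1 : ℕ) : ZMod p) + 1)) = D + 12 * c := by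
        rw [hD, hc]; push_cast; ring
      have hE' : (((j + 1 : ℕ) : ZMod p) * (((j + 1 : ℕ) : ZMod p) + 1) * (9 * ((j + 1 : ℕ) : ZMod p) ^ 2 + 7 * ((j + 1 : ℕ) : ZMod p) - 1)) = E + 6 * c * D + 30 * c ^ 2 := by
        rw [hD, hE, hc]; push_cast; ring
      rw [hD', hE']
      simp only [C_add, C_mul, C_pow]
      have n2 : (C 2 : (ZMod p)[X]) = 2 := rfl
      have n3 : (C 20 : (ZMod p)[X]) = 20 := rfl
      have n4 : (C 15 : (ZMod p)[X]) = 15 := rfl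
      have n5 : (C 6 : (ZMod p)[X]) = 6 := rfl
      have n6 : (C 12 : (ZMod p)[X]) = 12 := rfl
      have n7 : (C 30 : (ZMod p)[X]) = 30 := rfl
      rw [n2, n3, n4, n5, n6, n7]
      ring

lemma risePoly_natDegree (p j : ℕ) [Fact p.Prime] : (risePoly p j ^ 6).natDegree ≤ 6 * j := by
  refine Polynomial.natDegree_pow_le.trans ?_
  apply Nat.mul_le_mul_left
  refine (Polynomial.natDegree_prod_le _ _).trans ?_
  refine (Finset.sum_le_sum (g := fun _ => 1) ?_).trans (by simp)
  intro i _
  rw [Polynomial.natDegree_X_add_C]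

lemma degTwo (p : ℕ) [Fact p.Prime] (hp : 7 < p) (h5 : p % 6 = 5) :
    (truncPoly seqTwo p).natDegree = (5 * p - 7) / 6 := by
  obtain ⟨j, hj⟩ : ∃ j, p + 1 = 6 * j := ⟨(p + 1) / 6, by omega⟩
  have hfac : ∀ i, i < p → (i.factorial : ZMod p) ≠ 0 := by
    intro i hi
    rw [Ne, ZMod.natCast_eq_zero_iff, (Fact.out : p.Prime).dvd_factorial]
    omega
  apply truncPoly_natDegree
  · omega
  · have h := seqTwo_eq_sum p j (by omega)
    rw [show p - 1 - j = (5 * p - 7) / 6 by omega,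
      sum_eval p (by omega) _ (lt_of_le_of_lt (risePoly_natDegree p j) (by omega))] at h
    intro h0
    rw [h0, zero_mul] at h
    obtain ⟨T, hT, hh⟩ := risePoly_top p j
    have hc := congrArg (fun F => Polynomial.coeff F (p - 1 + 2)) hh
    rw [Polynomial.coeff_X_pow_mul, Polynomial.coeff_C_mul, Polynomial.coeff_add,
      Polynomial.coeff_eq_zero_of_degree_lt (hT.trans_le (by rw [← hj, show p - 1 + 2 = p + 1 by omega])),
      show p - 1 + 2 = 0 + 6 * j by omega, Polynomial.coeff_X_pow_mul] at hc
    simp only [neg_eq_zero.1 h.symm] at hc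
    simp only [Polynomial.coeff_add, Polynomial.coeff_C_mul, Polynomial.coeff_C_zero,
      Polynomial.coeff_X_zero, Polynomial.coeff_X_pow, mul_zero, zero_add, add_zero] at hc
    norm_num only [mul_zero, zero_add, add_zero, if_false] at hc
    have h6 : (6 : ZMod p) * j = 1 := by
      have := congrArg (Nat.cast : ℕ → ZMod p) hj
      push_cast at this
      rw [← this]; simp
    have h35 : (105 : ZMod p) = 0 := by
      have key : ∀ x : ZMod p, 6 * x = 1 → x * (x + 1) * (9 * x ^ 2 + 7 * x - 1) = 0 → (105 : ZMod p) = 0 := by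
        intro x hx hz
        have : x * (x + 1) * (9 * x ^ 2 + 7 * x - 1) * (6 ^ 4) = 
            (6 * x) * (6 * x + 6) * (9 * (6 * x) ^ 2 + 42 * (6 * x) - 36) := by ring
        rw [hz, hx] at this
        linear_combination -this
      apply key j h6
      linear_combination -hc
    have h105 : p ∣ 3 * 5 * 7 := by
      rw [← ZMod.natCast_eq_zero_iff]
      exact_mod_cast h35
    have hpp := (Fact.out : p.Prime)
    rcases (hpp.dvd_mul).1 h105 with hd | hd
    · rcases (hpp.dvd_mul).1 hd with hd | hd
      · have := Nat.le_of_dvd (by norm_num) hd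
        omega
      · have := Nat.le_of_dvd (by norm_num) hd
        omega
    · have := Nat.le_of_dvd (by norm_num) hd
      omega
  · intro n hn hnp
    have h := seqTwo_eq_sum p (p - 1 - n) (by omega)
    rw [show p - 1 - (p - 1 - n) = n by omega] at h
    have hd : (risePoly p (p - 1 - n) ^ 6).natDegree < p - 1 :=
      lt_of_le_of_lt (risePoly_natDegree p _) (by omega)
    rw [sum_eval p (by omega) _ (by omega), Polynomial.coeff_eq_zero_of_natDegree_lt hd, neg_zero] at h
    exact (mul_eq_zero.1 h).resolve_right (pow_ne_zero _ (hfac _ (by omega)))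

noncomputable def intSeries (a : ℕ → ℕ) : PowerSeries ℤ := PowerSeries.mk fun n => (a n : ℤ)

lemma intSeries_map (a : ℕ → ℕ) (p : ℕ) :
    PowerSeries.map (Int.castRingHom (ZMod p)) (intSeries a) = modSeries a p := by
  ext n; simp [intSeries, modSeries]

lemma truncPoly_ne_zero (a : ℕ → ℕ) (p : ℕ) [Fact p.Prime] (h : a 0 = 1) : truncPoly a p ≠ 0 := by
  intro h0
  have := truncPoly_coeff a p 0
  rw [h0, if_pos (Fact.out : p.Prime).pos, h] at this
  simp at this

lemma transfer (S : Finset (ℕ × ℕ)) (c : ℕ × ℕ → Polynomial ℤ) (w : ℕ × ℕ → ℕ)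
    (hrel : ∑ m ∈ S, (c m : PowerSeries ℤ) * (intSeries seqOne ^ m.1 * intSeries seqTwo ^ m.2) = 0)
    (hinf : ∀ N, ∃ p > N, p.Prime ∧ p % 6 = 5 ∧ ∀ m ∈ S, ∀ m' ∈ S,
      m.1 * (p / 4) + m.2 * ((5 * p - 7) / 6) ≡ m'.1 * (p / 4) + m'.2 * ((5 * p - 7) / 6) [MOD (p - 1)] →
        w m = w m') (t : ℕ) :
    ∑ m ∈ S with w m = t,
      (c m : PowerSeries ℤ) * (intSeries seqOne ^ m.1 * intSeries seqTwo ^ m.2) = 0 := by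
  ext n
  set V := PowerSeries.coeff n (∑ m ∈ S with w m = t,
      (c m : PowerSeries ℤ) * (intSeries seqOne ^ m.1 * intSeries seqTwo ^ m.2)) with hV
  obtain ⟨p, hpN, hp, h5, hw⟩ := hinf (V.natAbs + 7)
  have : Fact p.Prime := ⟨hp⟩
  have hA1 : truncPoly seqOne p ≠ 0 := truncPoly_ne_zero _ _ (by simp [seqOne])
  have hA2 : truncPoly seqTwo p ≠ 0 := truncPoly_ne_zero _ _ (by simp [seqTwo])
  have hd1 : (truncPoly seqOne p).natDegree = p / 4 := (degOne p).resolve_right (by omega)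
  have hd2 := degTwo p (by omega) h5
  have hmap : ∀ T : Finset (ℕ × ℕ), PowerSeries.map (Int.castRingHom (ZMod p)) (∑ m ∈ T,
      (c m : PowerSeries ℤ) * (intSeries seqOne ^ m.1 * intSeries seqTwo ^ m.2)) =
      ∑ m ∈ T, (((c m).map (Int.castRingHom (ZMod p)) : Polynomial (ZMod p)) : PowerSeries (ZMod p)) *
        (modSeries seqOne p ^ m.1 * modSeries seqTwo p ^ m.2) := by
    intro T
    rw [map_sum]
    apply Finset.sum_congr rfl
    intro m _
    rw [map_mul, map_mul, map_pow, map_pow, intSeries_map, intSeries_map, Polynomial.polynomial_map_coe]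
  have key := split_classes p (fun m : ℕ × ℕ => modSeries seqOne p ^ m.1 * modSeries seqTwo p ^ m.2)
    (fun m => truncPoly seqOne p ^ m.1 * truncPoly seqTwo p ^ m.2)
    (fun m => mul_ne_zero (pow_ne_zero _ hA1) (pow_ne_zero _ hA2))
    (by
      intro m
      have l1 := lucas_series seqOne p (seqOne_lucas p)
      have l2 := lucas_series seqTwo p (seqTwo_lucas p)
      rw [Polynomial.coe_mul, Polynomial.coe_pow, Polynomial.coe_pow]
      conv_lhs => rw [l1, l2]
      ring) w S.card S rfl
    (by
      intro m hm m' hm' h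
      apply hw m hm m' hm'
      simpa only [Polynomial.natDegree_mul (pow_ne_zero _ hA1) (pow_ne_zero _ hA2),
        Polynomial.natDegree_pow, hd1, hd2] using h)
    (fun m => (c m).map (Int.castRingHom (ZMod p)))
    (by rw [← hmap, hrel, map_zero]) t
  rw [← hmap] at key
  have h0 : ((V : ℤ) : ZMod p) = 0 := by
    have := congrArg (PowerSeries.coeff n) key
    rw [PowerSeries.coeff_map] at this
    simpa [hV] using this
  rw [ZMod.intCast_zmod_eq_zero_iff_dvd] at h0
  rw [map_zero]
  apply Int.eq_zero_of_abs_lt_dvd h0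
  rw [Int.abs_eq_natAbs]
  omega

lemma prime_class (a : ℕ) (ha : a.Coprime 12) (ha' : a < 12) (N : ℕ) :
    ∃ p > N, p.Prime ∧ p % 12 = a := by
  obtain ⟨p, h1, h2, h3⟩ := Nat.forall_exists_prime_gt_and_modEq N (q := 12) (a := a) (by norm_num) ha
  exact ⟨p, h1, h2, by
    have h4 : p % 12 = a % 12 := h3
    omega⟩

lemma int_rel_trivial (S : Finset (ℕ × ℕ)) (c : ℕ × ℕ → Polynomial ℤ)
    (hrel : ∑ m ∈ S, (c m : PowerSeries ℤ) * (intSeries seqOne ^ m.1 * intSeries seqTwo ^ m.2) = 0) :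
    ∀ m ∈ S, c m = 0 := by
  intro m0 hm0
  obtain ⟨M, hM⟩ : ∃ M, ∀ m ∈ S, m.1 ≤ M ∧ m.2 ≤ M :=
    ⟨S.sup (fun m => m.1 + m.2), fun m hm => by
      have := Finset.le_sup (f := fun m : ℕ × ℕ => m.1 + m.2) hm
      omega⟩
  have h1 := transfer S c (fun m => 3 * m.1 + 2 * m.2) hrel (by
    intro N
    obtain ⟨p, hpN, hp, h12⟩ := prime_class 11 (by decide) (by norm_num) (N + 10 * M + 10)
    refine ⟨p, by omega, hp, by omega, ?_⟩
    intro m hm m' hm' h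
    have b := hM m hm
    have b' := hM m' hm'
    obtain ⟨q, rfl⟩ : ∃ q, p = 12 * q + 11 := ⟨p / 12, by omega⟩
    rw [show (12 * q + 11) / 4 = 3 * q + 2 by omega,
      show (5 * (12 * q + 11) - 7) / 6 = 10 * q + 8 by omega,
      show 12 * q + 11 - 1 = 12 * q + 10 by omega] at h
    rw [Nat.modEq_iff_dvd] at h
    obtain ⟨k, hk⟩ := h
    push_cast at hk
    have hz : (6 * ((m'.1 : ℤ) - m.1) + 4 * ((m'.2 : ℤ) - m.2)) = 0 := by
      apply Int.eq_zero_of_abs_lt_dvd (m := 12 * (q : ℤ) + 10)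
      · refine ⟨(3 * ((m'.1 : ℤ) - m.1) + 10 * ((m'.2 : ℤ) - m.2)) - 12 * k, ?_⟩
        linear_combination (-12) * hk
      · rw [abs_lt]; constructor <;> omega
    show 3 * m.1 + 2 * m.2 = 3 * m'.1 + 2 * m'.2
    omega) (3 * m0.1 + 2 * m0.2)
  have h2 := transfer _ c (fun m => m.2) h1 (by
    intro N
    obtain ⟨p, hpN, hp, h12⟩ := prime_class 5 (by decide) (by norm_num) (N + 10 * M + 10)
    refine ⟨p, by omega, hp, by omega, ?_⟩
    intro m hm m' hm' h
    have b := hM m (Finset.mem_filter.1 hm).1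
    have b' := hM m' (Finset.mem_filter.1 hm').1
    obtain ⟨q, rfl⟩ : ∃ q, p = 12 * q + 5 := ⟨p / 12, by omega⟩
    rw [show (12 * q + 5) / 4 = 3 * q + 1 by omega,
      show (5 * (12 * q + 5) - 7) / 6 = 10 * q + 3 by omega,
      show 12 * q + 5 - 1 = 12 * q + 4 by omega] at h
    rw [Nat.modEq_iff_dvd] at h
    obtain ⟨k, hk⟩ := h
    push_cast at hk
    have hz : (4 * ((m'.2 : ℤ) - m.2)) = 0 := by
      apply Int.eq_zero_of_abs_lt_dvd (m := 12 * (q : ℤ) + 4)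
      · refine ⟨(3 * ((m'.1 : ℤ) - m.1) + 10 * ((m'.2 : ℤ) - m.2)) - 12 * k, ?_⟩
        linear_combination (-12) * hk
      · rw [abs_lt]; constructor <;> omega
    show m.2 = m'.2
    omega) m0.2
  have hs : ({m ∈ {m ∈ S | 3 * m.1 + 2 * m.2 = 3 * m0.1 + 2 * m0.2} | m.2 = m0.2} : Finset (ℕ × ℕ)) = {m0} := by
    ext m
    simp only [Finset.mem_filter, Finset.mem_singleton]
    constructor
    · rintro ⟨⟨_, h⟩, h'⟩
      exact Prod.ext (by omega) h'
    · rintro rfl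
      exact ⟨⟨hm0, rfl⟩, rfl⟩
  rw [hs, Finset.sum_singleton] at h2
  have n1 : intSeries seqOne ≠ 0 := by
    intro h
    have := congrArg (PowerSeries.coeff 0) h
    simp [intSeries, seqOne] at this
  have n2 : intSeries seqTwo ≠ 0 := by
    intro h
    have := congrArg (PowerSeries.coeff 0) h
    simp [intSeries, seqTwo] at this
  have := (mul_eq_zero.1 h2).resolve_right (mul_ne_zero (pow_ne_zero _ n1) (pow_ne_zero _ n2))
  simpa using this

lemma ratioSeries_eq : PowerSeries.map (Int.castRingHom ℚ) (intSeries seqOne) = ratioSeries := by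
  ext n
  have h1 := Nat.choose_mul_factorial_mul_factorial (show 2 * n ≤ 2 * (2 * n) by omega)
  have h2 := Nat.choose_mul_factorial_mul_factorial (show n ≤ 2 * n by omega)
  rw [show 2 * (2 * n) - 2 * n = 2 * n by omega] at h1
  rw [show 2 * n - n = n by omega] at h2
  simp only [PowerSeries.coeff_map, intSeries, ratioSeries, PowerSeries.coeff_mk, seqOne, Nat.centralBinom]
  rw [eq_div_iff (by positivity), show 4 * n = 2 * (2 * n) by ring, ← h1]
  have h3 := congrArg (Nat.cast : ℕ → ℚ) h2
  push_cast at h3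
  push_cast
  simp only [eq_intCast, Int.cast_mul, Int.cast_natCast]
  linear_combination ((2 * (2 * n)).choose (2 * n) : ℚ) * ((2 * n).factorial : ℚ) * h3

lemma franelSixSeries_eq : PowerSeries.map (Int.castRingHom ℚ) (intSeries seqTwo) = franelSixSeries := by
  ext n
  simp [intSeries, franelSixSeries, seqTwo]

/-- The power series `∑ (4n)!/((2n)!·n!²) zⁿ` and
`∑ (∑_{k=0}^n C(n,k)^6) zⁿ` are algebraically independent over `ℚ(z)`. -/
theorem ratioSeries_franelSixSeries_algebraically_independent :
    AlgebraicIndependent (Polynomial ℚ) ![ratioSeries, franelSixSeries] := by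
  rw [algebraicIndependent_iff]
  intro P hP
  rw [MvPolynomial.aeval_def, MvPolynomial.eval₂_eq'] at hP
  simp only [Fin.prod_univ_two, Matrix.cons_val_zero, Matrix.cons_val_one] at hP
  have hden : ∀ q : Polynomial ℚ, ∃ b : ℤ, b ≠ 0 ∧ ∃ r : Polynomial ℤ,
      r.map (Int.castRingHom ℚ) = Polynomial.C (b : ℚ) * q := by
    intro q
    obtain ⟨b, hbM, hb⟩ := IsLocalization.integerNormalization_spec (nonZeroDivisors ℤ) q
    refine ⟨b, nonZeroDivisors.ne_zero hbM, IsLocalization.integerNormalization (nonZeroDivisors ℤ) q, ?_⟩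
    rw [← eq_intCast (algebraMap ℤ ℚ) b]
    refine hb.trans ?_
    ext n
    simp
  choose b hb0 r hr using hden
  set c : ℕ × ℕ → Polynomial ℤ := fun m =>
    Polynomial.C (∏ d ∈ P.support.erase (Finsupp.equivFunOnFinite.symm ![m.1, m.2]), b (P.coeff d)) *
      r (P.coeff (Finsupp.equivFunOnFinite.symm ![m.1, m.2])) with hc
  have hinv : ∀ d : Fin 2 →₀ ℕ, Finsupp.equivFunOnFinite.symm ![d 0, d 1] = d := by
    intro d
    ext i
    fin_cases i <;> simp
  have hinj : Function.Injective (fun d : Fin 2 →₀ ℕ => (d 0, d 1)) := by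
    intro d d' h
    simp only [Prod.mk.injEq] at h
    rw [← hinv d, ← hinv d', h.1, h.2]
  set N : ℤ := ∏ d ∈ P.support, b (P.coeff d) with hN
  have hcd : ∀ d ∈ P.support, (c (d 0, d 1)).map (Int.castRingHom ℚ) =
      Polynomial.C (N : ℚ) * P.coeff d := by
    intro d hd
    simp only [hc, hinv]
    rw [Polynomial.map_mul, hr, Polynomial.map_C, ← mul_assoc, ← Polynomial.C_mul, hN,
      ← Finset.mul_prod_erase _ _ hd]
    push_cast
    simp [mul_comm]
  have hrel : ∑ m ∈ P.support.image (fun d : Fin 2 →₀ ℕ => (d 0, d 1)),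
      (c m : PowerSeries ℤ) * (intSeries seqOne ^ m.1 * intSeries seqTwo ^ m.2) = 0 := by
    apply PowerSeries.map_injective (Int.castRingHom ℚ) Int.cast_injective
    rw [Finset.sum_image (fun _ _ _ _ h => hinj h), map_sum, map_zero]
    have h2 := congrArg (fun x => ((Polynomial.C (N : ℚ) : Polynomial ℚ) : PowerSeries ℚ) * x) hP
    simp only [mul_zero, Finset.mul_sum] at h2
    rw [← h2]
    apply Finset.sum_congr rfl
    intro d hd
    rw [map_mul, map_mul, map_pow, map_pow, ratioSeries_eq, franelSixSeries_eq,
      ← Polynomial.polynomial_map_coe, hcd d hd, Polynomial.coe_mul, mul_assoc,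
      PowerSeries.algebraMap_apply']
    simp
  have hz := int_rel_trivial _ c hrel
  ext1 d
  by_contra hne
  have hd : d ∈ P.support := by
    rw [MvPolynomial.mem_support_iff]
    simpa using hne
  have h3 := hcd d hd
  rw [hz _ (Finset.mem_image_of_mem _ hd), Polynomial.map_zero] at h3
  rcases mul_eq_zero.1 h3.symm with h4 | h4
  · have : N ≠ 0 := Finset.prod_ne_zero_iff.2 (fun d _ => hb0 _)
    simp at h4
    exact this h4
  · exact hne (by simpa using h4)
end

section
/- Let d ≥ 1 and let u = ((α_1,e_1),…,(α_r,e_r)) and v = ((β_1,f_1),…,(β_s,f_s)) be tuples with α_i, β_j ∈ ℚ ∩ (0,1] and e_i, f_j ∈ ℕ^d, satisfying Σ_{i=1}^r e_i = Σ_{j=1}^s f_j. Suppose that ξ_1(x) ≥ 1 for every x ∈ D^1_{u,v}. Then for every prime p with p ≡ 1 mod d_{α,β}, the family Q_{u,v}(n) takes values in ℤ_(p) and has the p-Lucas property: Q_{u,v}(a + p·m) ≡ Q_{u,v}(a)·Q_{u,v}(m) mod p·ℤ_(p) for all a ∈ {0,…,p−1}^d and m ∈ ℕ^d. -/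
section aux
open Finset

lemma aux_step (q N a t n : ℕ) (hq : q = 1 + N * t) (ha : 0 < a) (haN : a ≤ N)
    (x : ℝ) (hx : x * N = a) :
    ⌊((n + 1 : ℕ) : ℝ) / q - x⌋ = ⌊(n : ℝ) / q - x⌋ + if q ∣ a + n * N then 1 else 0 := by
  have hN : 0 < N := by omega
  have hNR : (0 : ℝ) < N := by exact_mod_cast hN
  have hx0 : 0 < x := by
    have : (0 : ℝ) < a := by exact_mod_cast ha
    by_contra h
    push Not at h
    nlinarith
  have hx1 : x ≤ 1 := by
    have : (a : ℝ) ≤ N := by exact_mod_cast haN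
    by_contra h
    push Not at h
    nlinarith
  have hq0 : 0 < q := by omega
  have hqR : (0 : ℝ) < q := by exact_mod_cast hq0
  have hqx : (q : ℝ) * x = (t * a : ℕ) + x := by
    subst hq; push_cast; rw [← hx]; ring
  obtain ⟨c, hc⟩ : ∃ c : ℕ, c = t * a := ⟨_, rfl⟩
  rw [← hc] at hqx
  -- divisibility criterion
  have hdvd : q ∣ a + n * N ↔ (q : ℤ) ∣ (n : ℤ) - c := by
    have h1 : ((a + n * N : ℕ) : ℤ) = N * ((n : ℤ) - c) + q * a := by
      subst hq hc; push_cast; ring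
    rw [← Int.natCast_dvd_natCast, h1, dvd_add_left (dvd_mul_right _ _)]
    have hcop : IsCoprime (q : ℤ) (N : ℤ) := ⟨1, -t, by subst hq; push_cast; ring⟩
    constructor
    · exact hcop.dvd_of_dvd_mul_left
    · exact fun h => Dvd.dvd.mul_left h _
  obtain ⟨z, hz⟩ : ∃ z, z = ⌊(n : ℝ) / q - x⌋ := ⟨_, rfl⟩
  rw [← hz]
  have hz' := Int.floor_eq_iff.1 hz.symm
  have e1 : (n : ℝ) / q * q = n := by field_simp
  have e2 : ((n + 1 : ℕ) : ℝ) / q * q = n + 1 := by field_simp; push_cast; ring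
  have l1 : (z : ℝ) * q + c + x ≤ n := by nlinarith
  have l2 : (n : ℝ) < (z + 1) * q + c + x := by nlinarith
  have l1' : z * q + c < n := by
    have : (z : ℝ) * q + c < n := by linarith
    exact_mod_cast this
  have l2' : (n : ℤ) < (z + 1) * q + c + 1 := by
    have : (n : ℝ) < (z + 1) * q + c + 1 := by linarith
    exact_mod_cast this
  rw [Int.floor_eq_iff]
  by_cases h : (n : ℤ) = (z + 1) * q + c
  · have hR : (n : ℝ) = (z + 1) * q + c := by exact_mod_cast h
    rw [if_pos (hdvd.2 ⟨z + 1, by rw [h]; ring⟩)]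
    have hq1 : (1 : ℝ) ≤ q := by exact_mod_cast hq0
    push_cast
    push_cast at e2
    constructor
    · by_contra hh
      push Not at hh
      nlinarith
    · by_contra hh
      push Not at hh
      nlinarith
  · have h3 : (n : ℤ) + 1 ≤ (z + 1) * q + c := by omega
    have h3R : (n : ℝ) + 1 ≤ (z + 1) * q + c := by exact_mod_cast h3
    rw [if_neg]
    · push_cast
      push_cast at e2
      constructor
      · by_contra hh
        push Not at hh
        nlinarith
      · by_contra hh
        push Not at hh
        nlinarith
    · rw [hdvd]
      rintro ⟨k, hk⟩
      have hqZ : (0 : ℤ) < q := by exact_mod_cast hq0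
      have : z < k := by
        by_contra hh
        push Not at hh
        nlinarith
      have : k < z + 1 := by
        by_contra hh
        push Not at hh
        nlinarith
      omega

lemma aux_val (p : ℕ) [hp : Fact p.Prime] (α : ℚ) (h0 : 0 < α) (h1 : α ≤ 1) (hN : α.den ∣ p - 1)
    (L : ℕ) (n : ℕ) (hL : α.num.toNat + n * α.den < p ^ L) :
    padicValRat p ((ascPochhammer ℚ n).eval α) =
      ∑ l ∈ Ico 1 L, (⌊(n : ℝ) / (p ^ l : ℕ) - (α : ℝ)⌋ + 1) := by
  obtain ⟨a, ha⟩ : ∃ a : ℕ, a = α.num.toNat := ⟨_, rfl⟩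
  have hnum : (α.num : ℤ) = a := by
    rw [ha, Int.toNat_of_nonneg (Rat.num_nonneg.2 h0.le)]
  have ha0 : 0 < a := by
    have := Rat.num_pos.2 h0
    omega
  have hαa : α * α.den = a := by
    rw [Rat.mul_den_eq_num, hnum]; simp
  have hd0 : (0 : ℚ) < α.den := by exact_mod_cast α.den_pos
  have haN : a ≤ α.den := by
    have : (a : ℚ) ≤ α.den := by rw [← hαa]; nlinarith
    exact_mod_cast this
  have hp1 := hp.out.one_lt
  have hden : ¬ p ∣ α.den := by
    intro h
    have := Nat.le_of_dvd (by omega) (h.trans hN)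
    omega
  rw [← ha] at hL
  induction n with
  | zero =>
    simp only [ascPochhammer_zero, Polynomial.eval_one, padicValRat.one, Nat.cast_zero, zero_div,
      zero_sub]
    symm
    apply Finset.sum_eq_zero
    intro l _
    have : ⌊-(α : ℝ)⌋ = -1 := by
      rw [Int.floor_eq_iff]
      have : (0 : ℝ) < α := by exact_mod_cast h0
      have : (α : ℝ) ≤ 1 := by exact_mod_cast h1
      push_cast
      constructor <;> linarith
    rw [this]; norm_num
  | succ n ih =>
    have hpos : 0 < (ascPochhammer ℚ n).eval α := ascPochhammer_pos n α h0
    have hk : 0 < α + n := by positivity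
    rw [ascPochhammer_succ_eval, padicValRat.mul hpos.ne' hk.ne', ih (by nlinarith)]
    have hval : padicValRat p (α + n) = ((a + n * α.den).factorization p : ℤ) := by
      have : α + n = ((a + n * α.den : ℕ) : ℚ) / (α.den : ℕ) := by
        push_cast
        rw [← hαa]
        field_simp
      rw [this, padicValRat.div (by positivity) hd0.ne', padicValRat.of_nat, padicValRat.of_nat,
        padicValNat.eq_zero_of_not_dvd hden, Nat.factorization_def _ hp.out]
      simp
    rw [hval, Nat.factorization_eq_card_pow_dvd_of_lt hp.out (b := L) (by omega) (by nlinarith),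
      Finset.card_filter]
    push_cast
    rw [← Finset.sum_add_distrib]
    apply Finset.sum_congr rfl
    intro l _
    have hdl : α.den ∣ p ^ l - 1 := hN.trans (by simpa using Nat.sub_dvd_pow_sub_pow p 1 l)
    obtain ⟨t, ht⟩ := hdl
    have : 0 < p ^ l := by positivity
    have := aux_step (p ^ l) α.den a t n (by omega) ha0 haN (α : ℝ) (by exact_mod_cast hαa)
    push_cast at this
    rw [this]
    ring

lemma aux_int {p : ℕ} [hp : Fact p.Prime] {x : ℚ} (h : 0 ≤ padicValRat p x) :
    ¬ (p : ℤ) ∣ x.den := by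
  intro h2
  have h2 : p ∣ x.den := by exact_mod_cast h2
  have h3 : ¬ (p : ℤ) ∣ x.num := by
    intro h4
    have h5 : p ∣ x.num.natAbs := by rwa [← Int.natCast_dvd]
    exact hp.out.one_lt.ne' (Nat.eq_one_of_dvd_coprimes x.reduced h5 h2)
  rw [padicValRat_def, padicValInt.eq_zero_of_not_dvd h3] at h
  have := one_le_padicValNat_of_dvd x.den_ne_zero h2
  omega

lemma aux_int' {p : ℕ} {x : ℚ} (h : 1 ≤ padicValRat p x) :
    (p : ℤ) ∣ x.num := by
  by_contra h2
  rw [padicValRat_def, padicValInt.eq_zero_of_not_dvd h2] at h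
  omega

/-- `h` is a rational number congruent to one modulo `p`. -/
def OneMod (p : ℕ) (h : ℚ) : Prop := ∃ x y : ℤ, ¬ (p : ℤ) ∣ y ∧ (p : ℤ) ∣ x - y ∧ h * y = x

lemma OneMod.one {p : ℕ} (hp : p.Prime) : OneMod p 1 :=
  ⟨1, 1, by
    intro h
    exact hp.one_lt.ne' (by exact_mod_cast Int.eq_one_of_dvd_one (by positivity) h), by simp, by simp⟩

lemma OneMod.mul {p : ℕ} (hp : p.Prime) {g h : ℚ} (hg : OneMod p g) (hh : OneMod p h) :
    OneMod p (g * h) := by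
  obtain ⟨x, y, h1, h2, h3⟩ := hg
  obtain ⟨z, w, h4, h5, h6⟩ := hh
  refine ⟨x * z, y * w, ?_, ?_, ?_⟩
  · intro h
    rcases (Nat.prime_iff_prime_int.1 hp).dvd_or_dvd h with h | h <;> contradiction
  · have : x * z - y * w = (x - y) * z + y * (z - w) := by ring
    rw [this]
    exact dvd_add (h2.mul_right _) (h5.mul_left _)
  · push_cast
    rw [← h3, ← h6]; ring

lemma OneMod.inv {p : ℕ} {g : ℚ} (hg : OneMod p g) : OneMod p g⁻¹ := by
  obtain ⟨x, y, h1, h2, h3⟩ := hg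
  have hx : ¬ (p : ℤ) ∣ x := fun h => h1 (by simpa using dvd_sub h h2)
  refine ⟨y, x, hx, by rw [← neg_sub, dvd_neg]; exact h2, ?_⟩
  have hg : g ≠ 0 := by
    rintro rfl
    simp at h3
    apply hx
    have : x = 0 := by exact_mod_cast h3.symm
    simp [this]
  rw [← h3]; field_simp

lemma OneMod.prod {p : ℕ} (hp : p.Prime) {ι : Type*} (s : Finset ι) (g : ι → ℚ)
    (h : ∀ i ∈ s, OneMod p (g i)) : OneMod p (∏ i ∈ s, g i) :=
  Finset.prod_induction _ _ (fun _ _ => OneMod.mul hp) (OneMod.one hp) h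

lemma aux_wilson (p : ℕ) [hp : Fact p.Prime] (g : ℕ → ZMod p) (N b : ZMod p) (hN : N ≠ 0)
    (hg : ∀ k, g k = b + k * N) (k0 : ℕ) (hk0 : k0 < p) (h0 : g k0 = 0) :
    ∏ k ∈ (range p).erase k0, g k = -1 := by
  have hp1 := hp.out.one_lt
  have hinj : ∀ k ∈ range p, ∀ l ∈ range p, g k = g l → k = l := by
    intro k hk l hl h
    rw [hg, hg] at h
    have h2 := mul_right_cancel₀ hN (add_left_cancel h)
    rw [ZMod.natCast_eq_natCast_iff'] at h2
    rwa [Nat.mod_eq_of_lt (mem_range.1 hk), Nat.mod_eq_of_lt (mem_range.1 hl)] at h2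
  have himg : ((range p).erase k0).image g = Finset.univ.erase 0 := by
    apply Finset.eq_of_subset_of_card_le
    · intro z hz
      obtain ⟨k, hk, rfl⟩ := Finset.mem_image.1 hz
      rw [Finset.mem_erase] at hk ⊢
      refine ⟨fun h => hk.1 ?_, Finset.mem_univ _⟩
      exact hinj k hk.2 k0 (mem_range.2 hk0) (h.trans h0.symm)
    · rw [Finset.card_image_of_injOn, Finset.card_erase_of_mem (Finset.mem_univ _),
        Finset.card_erase_of_mem (mem_range.2 hk0), Finset.card_univ, ZMod.card, Finset.card_range]
      intro k hk l hl h
      exact hinj k (Finset.mem_of_mem_erase hk) l (Finset.mem_of_mem_erase hl) h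
  rw [← Finset.prod_image (g := g) (f := fun z => z)
    (fun k hk l hl h => hinj k (Finset.mem_of_mem_erase hk) l (Finset.mem_of_mem_erase hl) h), himg]
  have himg2 : (Ico 1 p).image (fun k : ℕ => (k : ZMod p)) = Finset.univ.erase 0 := by
    have hi : ∀ k ∈ Ico 1 p, ∀ l ∈ Ico 1 p, (k : ZMod p) = l → k = l := by
      intro k hk l hl h
      rw [ZMod.natCast_eq_natCast_iff'] at h
      rwa [Nat.mod_eq_of_lt (mem_Ico.1 hk).2, Nat.mod_eq_of_lt (mem_Ico.1 hl).2] at h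
    apply Finset.eq_of_subset_of_card_le
    · intro z hz
      obtain ⟨k, hk, rfl⟩ := Finset.mem_image.1 hz
      rw [mem_Ico] at hk
      rw [Finset.mem_erase]
      refine ⟨fun h => ?_, Finset.mem_univ _⟩
      rw [ZMod.natCast_eq_zero_iff] at h
      have := Nat.le_of_dvd (by omega) h
      omega
    · rw [Finset.card_image_of_injOn (fun k hk l hl h => hi k hk l hl h),
        Finset.card_erase_of_mem (Finset.mem_univ _),
        Finset.card_univ, ZMod.card, Nat.card_Ico]
  rw [← himg2, Finset.prod_image, ZMod.prod_Ico_one_prime]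
  intro k hk l hl h
  simp only [ZMod.natCast_eq_natCast_iff'] at h
  rwa [Nat.mod_eq_of_lt (mem_Ico.1 hk).2, Nat.mod_eq_of_lt (mem_Ico.1 hl).2] at h

lemma aux_poch_add (α : ℚ) (n k : ℕ) : (ascPochhammer ℚ (n + k)).eval α =
    (ascPochhammer ℚ n).eval α * ∏ j ∈ range k, (α + n + j) := by
  induction k with
  | zero => simp
  | succ k ih =>
    rw [← add_assoc, ascPochhammer_succ_eval, ih, Finset.prod_range_succ]
    push_cast; ring

lemma aux_block (p : ℕ) [hp : Fact p.Prime] (α : ℚ) (h0 : 0 < α) (h1 : α ≤ 1)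
    (hN : α.den ∣ p - 1) (v m : ℕ) (hv : (v : ℚ) < p * α) :
    ∃ h, OneMod p h ∧ ∏ j ∈ range p, (α + (v + p * m : ℕ) + j) = (-p) * (α + m) * h := by
  obtain ⟨a, ha⟩ : ∃ a : ℕ, a = α.num.toNat := ⟨_, rfl⟩
  have hnum : (α.num : ℤ) = a := by
    rw [ha, Int.toNat_of_nonneg (Rat.num_nonneg.2 h0.le)]
  have hαa : α * α.den = a := by
    rw [Rat.mul_den_eq_num, hnum]; simp
  have hd0 : (0 : ℚ) < α.den := by exact_mod_cast α.den_pos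
  have haN : a ≤ α.den := by
    have : (a : ℚ) ≤ α.den := by rw [← hαa]; nlinarith
    exact_mod_cast this
  have hp1 := hp.out.one_lt
  have hden : ¬ p ∣ α.den := by
    intro h
    have := Nat.le_of_dvd (by omega) (h.trans hN)
    omega
  obtain ⟨t, ht⟩ := hN
  have hpt : p = 1 + α.den * t := by omega
  have hptQ : (p : ℚ) = 1 + α.den * t := by exact_mod_cast hpt
  have hpa : (p : ℚ) * α = (t * a : ℕ) + α := by
    rw [hptQ]; push_cast; rw [← hαa]; ring
  obtain ⟨c, hc⟩ : ∃ c : ℕ, c = t * a := ⟨_, rfl⟩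
  rw [← hc] at hpa
  have hvc : v ≤ c := by
    have : (v : ℚ) < (c + 1 : ℕ) := by push_cast; linarith
    have : v < c + 1 := by exact_mod_cast this
    omega
  have hcp : c < p := by
    have : t * a ≤ t * α.den := Nat.mul_le_mul_left _ haN
    rw [hpt, hc]; nlinarith
  have hk0 : c - v < p := by omega
  rw [← Finset.mul_prod_erase _ _ (mem_range.2 hk0)]
  have e0 : α + (v + p * m : ℕ) + (c - v : ℕ) = p * (α + m) := by
    push_cast [hvc]; linarith
  rw [e0]
  refine ⟨-∏ j ∈ (range p).erase (c - v), (α + (v + p * m : ℕ) + j), ?_, by ring⟩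
  refine ⟨-∏ j ∈ (range p).erase (c - v), ((a + (v + p * m + j) * α.den : ℕ) : ℤ),
    (α.den : ℤ) ^ (p - 1), ?_, ?_, ?_⟩
  · intro h
    have := (Nat.prime_iff_prime_int.1 hp.out).dvd_of_dvd_pow h
    exact hden (by exact_mod_cast this)
  · have hdz : (α.den : ZMod p) ≠ 0 := by rwa [Ne, ZMod.natCast_eq_zero_iff]
    rw [← ZMod.intCast_eq_intCast_iff_dvd_sub]
    push_cast
    rw [ZMod.pow_card_sub_one_eq_one hdz,
      aux_wilson p (fun j : ℕ => (a : ZMod p) + (v + p * m + j) * α.den) α.den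
        (a + (v + p * m) * α.den) hdz (fun k => by ring) (c - v) hk0 ?_]
    · ring
    · have h3 : p ∣ a + c * α.den := ⟨a, by rw [hpt, hc]; ring⟩
      have h4 := (ZMod.natCast_eq_zero_iff _ p).2 h3
      push_cast [hvc] at h4 ⊢
      rw [ZMod.natCast_self]
      linear_combination h4
  · have hcard : ((range p).erase (c - v)).card = p - 1 := by
      rw [Finset.card_erase_of_mem (mem_range.2 hk0), Finset.card_range]
    push_cast
    rw [← hcard, neg_mul, Finset.prod_mul_pow_card]
    congr 1
    apply Finset.prod_congr rfl
    intro j _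
    rw [← hαa]; ring

lemma aux_lucas (p : ℕ) [hp : Fact p.Prime] (α : ℚ) (h0 : 0 < α) (h1 : α ≤ 1)
    (hN : α.den ∣ p - 1) (v m : ℕ) (hv : (v : ℚ) < p * α) :
    ∃ h, OneMod p h ∧ (ascPochhammer ℚ (v + p * m)).eval α =
      (ascPochhammer ℚ v).eval α * (ascPochhammer ℚ m).eval α * (-p) ^ m * h := by
  induction m with
  | zero => exact ⟨1, OneMod.one hp.out, by simp⟩
  | succ m ih =>
    obtain ⟨h, hh, he⟩ := ih
    obtain ⟨g, hg, hge⟩ := aux_block p α h0 h1 hN v m hv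
    refine ⟨h * g, hh.mul hp.out hg, ?_⟩
    rw [mul_add, mul_one, ← add_assoc, aux_poch_add, hge, he, ascPochhammer_succ_eval]
    ring

lemma aux_val_prod (p : ℕ) [hp : Fact p.Prime] {ι : Type*} (s : Finset ι) (g : ι → ℚ)
    (h : ∀ i, g i ≠ 0) : padicValRat p (∏ i ∈ s, g i) = ∑ i ∈ s, padicValRat p (g i) := by
  classical
  induction s using Finset.induction_on with
  | empty => simp
  | insert a s ha ih =>
    rw [Finset.prod_insert ha, Finset.sum_insert ha,
      padicValRat.mul (h a) (Finset.prod_ne_zero_iff.2 fun i _ => h i), ih]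

lemma aux_floor {d : ℕ} (e n : Fin d → ℕ) (q : ℕ) (hq : 0 < q) (x : ℝ) :
    ⌊((∑ j, e j * n j : ℕ) : ℝ) / q - x⌋ =
      ⌊(∑ j, (e j : ℝ) * (((n j % q : ℕ) : ℝ) / q)) - x⌋ + ∑ j, (e j : ℤ) * (n j / q : ℕ) := by
  have hqR : (0 : ℝ) < q := by exact_mod_cast hq
  obtain ⟨w, hw⟩ : ∃ w : Fin d → ℕ, ∀ j, w j = n j / q := ⟨_, fun _ => rfl⟩
  obtain ⟨u, hu⟩ : ∃ u : Fin d → ℕ, ∀ j, u j = n j % q := ⟨_, fun _ => rfl⟩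
  simp only [← hw, ← hu]
  rw [← Int.floor_add_intCast]
  congr 1
  have : ((∑ j, e j * n j : ℕ) : ℝ) / q =
      (∑ j, (e j : ℝ) * ((u j : ℝ) / q)) + ∑ j, (e j : ℝ) * (w j : ℝ) := by
    rw [← Finset.sum_add_distrib]
    push_cast
    rw [Finset.sum_div]
    apply Finset.sum_congr rfl
    intro j _
    have h : (n j : ℝ) = q * w j + u j := by
      rw [hw, hu]
      exact_mod_cast (Nat.div_add_mod (n j) q).symm
    rw [h]
    field_simp
    ring
  rw [this]
  push_cast
  ring

end aux


/-- Let `u = ((α₁,e₁),…,(α_r,e_r))`, `v = ((β₁,f₁),…,(β_s,f_s))` with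
`αᵢ, βⱼ ∈ ℚ ∩ (0,1]` and `eᵢ, fⱼ ∈ ℕ^d`, `∑ eᵢ = ∑ fⱼ`. Suppose that the step function
`ξ₁(x) = ∑ᵢ ⌊eᵢ·x − αᵢ⌋ − ∑ⱼ ⌊fⱼ·x − βⱼ⌋ + r − s` satisfies `ξ₁(x) ≥ 1` on
`D¹ = {x ∈ [0,1)^d : e·x ≥ α for some coordinate (α,e) of u or of v}`. Then for every prime
`p ≡ 1 mod d_{α,β}` the family `Q_{u,v}(n) = ∏(αᵢ)_{eᵢ·n} / ∏(βⱼ)_{fⱼ·n}` takes values in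
`ℤ_(p)` and has the `p`-Lucas property. -/
theorem multivariate_hypergeometric_p_lucas
    (d r s : ℕ) (hd : 0 < d)
    (α : Fin r → ℚ) (β : Fin s → ℚ)
    (e : Fin r → Fin d → ℕ) (f : Fin s → Fin d → ℕ)
    (hα : ∀ i, 0 < α i ∧ α i ≤ 1) (hβ : ∀ i, 0 < β i ∧ β i ≤ 1)
    (hbal : ∀ j : Fin d, ∑ i, e i j = ∑ i, f i j)
    (Q : (Fin d → ℕ) → ℚ)
    (hQ : Q = fun n =>
      (∏ i, (ascPochhammer ℚ (∑ j, e i j * n j)).eval (α i)) /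
      (∏ i, (ascPochhammer ℚ (∑ j, f i j * n j)).eval (β i)))
    (D : ℕ)
    (hD : D = Nat.lcm (Finset.univ.lcm fun i => (α i).den)
      (Finset.univ.lcm fun i => (β i).den))
    (hξ : ∀ x : Fin d → ℝ, (∀ j, 0 ≤ x j ∧ x j < 1) →
      ((∃ i, (α i : ℝ) ≤ ∑ j, (e i j : ℝ) * x j) ∨
        (∃ i, (β i : ℝ) ≤ ∑ j, (f i j : ℝ) * x j)) →
      1 ≤ (∑ i, ⌊(∑ j, (e i j : ℝ) * x j) - (α i : ℝ)⌋)
          - (∑ i, ⌊(∑ j, (f i j : ℝ) * x j) - (β i : ℝ)⌋) + (r : ℤ) - (s : ℤ)) :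
    ∀ p : ℕ, p.Prime → (p : ZMod D) = 1 →
      (∀ n : Fin d → ℕ, ∃ a b : ℤ, ¬ (p : ℤ) ∣ b ∧ (b : ℚ) * Q n = (a : ℚ)) ∧
      ∀ v m : Fin d → ℕ, (∀ j, v j < p) →
        ∃ a b : ℤ, (p : ℤ) ∣ a ∧ ¬ (p : ℤ) ∣ b ∧
          (b : ℚ) * (Q (fun j => v j + p * m j) - Q v * Q m) = (a : ℚ) := by
  intro p hp hpD
  haveI : Fact p.Prime := ⟨hp⟩
  have hp1 := hp.one_lt
  have hDp : D ∣ p - 1 := by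
    have h : ((p - 1 : ℕ) : ZMod D) = 0 := by
      rw [Nat.cast_sub hp1.le, hpD]; simp
    exact (ZMod.natCast_eq_zero_iff _ _).1 h
  have hαN : ∀ i, (α i).den ∣ p - 1 := fun i => by
    refine Dvd.dvd.trans ?_ hDp
    rw [hD]
    exact (Finset.dvd_lcm (f := fun i => (α i).den) (Finset.mem_univ i)).trans (Nat.dvd_lcm_left _ _)
  have hβN : ∀ i, (β i).den ∣ p - 1 := fun i => by
    refine Dvd.dvd.trans ?_ hDp
    rw [hD]
    exact (Finset.dvd_lcm (f := fun i => (β i).den) (Finset.mem_univ i)).trans (Nat.dvd_lcm_right _ _)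
  -- the step function
  obtain ⟨ξ, hξdef⟩ : ∃ ξ : (Fin d → ℝ) → ℤ, ∀ x, ξ x =
      (∑ i, ⌊(∑ j, (e i j : ℝ) * x j) - (α i : ℝ)⌋)
          - (∑ i, ⌊(∑ j, (f i j : ℝ) * x j) - (β i : ℝ)⌋) + (r : ℤ) - (s : ℤ) := ⟨_, fun _ => rfl⟩
  simp only [← hξdef] at hξ
  have hξ0 : ∀ x : Fin d → ℝ, (∀ j, 0 ≤ x j ∧ x j < 1) → 0 ≤ ξ x := by
    intro x hx
    by_cases h : ((∃ i, (α i : ℝ) ≤ ∑ j, (e i j : ℝ) * x j) ∨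
        (∃ i, (β i : ℝ) ≤ ∑ j, (f i j : ℝ) * x j))
    · exact zero_le_one.trans (hξ x hx h)
    · push Not at h
      have key : ∀ (γ : ℚ) (g : Fin d → ℕ), γ ≤ 1 → ∑ j, (g j : ℝ) * x j < γ →
          ⌊(∑ j, (g j : ℝ) * x j) - (γ : ℝ)⌋ = -1 := by
        intro γ g hγ hlt
        have h1 : 0 ≤ ∑ j, (g j : ℝ) * x j :=
          Finset.sum_nonneg fun j _ => mul_nonneg (by positivity) (hx j).1
        have h2 : (γ : ℝ) ≤ 1 := by exact_mod_cast hγ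
        rw [Int.floor_eq_iff]
        push_cast
        constructor <;> linarith
      rw [hξdef, Finset.sum_congr rfl fun i _ => key (α i) (e i) (hα i).2 (h.1 i),
        Finset.sum_congr rfl fun i _ => key (β i) (f i) (hβ i).2 (h.2 i)]
      simp
  have hcube : ∀ (n : Fin d → ℕ) (q : ℕ), 0 < q →
      ∀ j, 0 ≤ ((n j % q : ℕ) : ℝ) / q ∧ ((n j % q : ℕ) : ℝ) / q < 1 := by
    intro n q hq j
    have hqR : (0 : ℝ) < q := by exact_mod_cast hq
    refine ⟨by positivity, ?_⟩
    rw [div_lt_one hqR]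
    exact_mod_cast Nat.mod_lt _ hq
  have hT : ∀ (n : Fin d → ℕ) (q : ℕ), 0 < q →
      (∑ i, (⌊((∑ j, e i j * n j : ℕ) : ℝ) / q - (α i : ℝ)⌋ + 1)) -
      (∑ i, (⌊((∑ j, f i j * n j : ℕ) : ℝ) / q - (β i : ℝ)⌋ + 1)) =
      ξ (fun j => ((n j % q : ℕ) : ℝ) / q) := by
    intro n q hq
    have hb : ∑ i, ∑ j, (e i j : ℤ) * (n j / q : ℕ) = ∑ i, ∑ j, (f i j : ℤ) * (n j / q : ℕ) := by
      rw [Finset.sum_comm, Finset.sum_comm (s := (Finset.univ : Finset (Fin s)))]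
      apply Finset.sum_congr rfl
      intro j _
      rw [← Finset.sum_mul, ← Finset.sum_mul]
      congr 1
      exact_mod_cast hbal j
    rw [hξdef]
    simp only [aux_floor _ n q hq, Finset.sum_add_distrib]
    rw [hb]
    simp
    ring
  have hpos : ∀ (γ : ℚ) (k : ℕ), 0 < γ → (ascPochhammer ℚ k).eval γ ≠ 0 :=
    fun γ k h => (ascPochhammer_pos k γ h).ne'
  have hvalQ : ∀ n : Fin d → ℕ, ∃ L, 2 ≤ L ∧ padicValRat p (Q n) =
      ∑ l ∈ Finset.Ico 1 L, ξ (fun j => ((n j % (p ^ l) : ℕ) : ℝ) / (p ^ l : ℕ)) := by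
    intro n
    let A : Fin r → ℕ := fun i => (α i).num.toNat + (∑ j, e i j * n j) * (α i).den
    let B : Fin s → ℕ := fun i => (β i).num.toNat + (∑ j, f i j * n j) * (β i).den
    refine ⟨2 + ∑ i, A i + ∑ i, B i, by omega, ?_⟩
    have hA : ∀ i, A i < p ^ (2 + ∑ i, A i + ∑ i, B i) := by
      intro i
      have h1 : A i ≤ ∑ i, A i := Finset.single_le_sum (fun _ _ => Nat.zero_le _) (Finset.mem_univ i)
      exact lt_of_le_of_lt (by omega) (Nat.lt_pow_self hp1)
    have hB : ∀ i, B i < p ^ (2 + ∑ i, A i + ∑ i, B i) := by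
      intro i
      have h1 : B i ≤ ∑ i, B i := Finset.single_le_sum (fun _ _ => Nat.zero_le _) (Finset.mem_univ i)
      exact lt_of_le_of_lt (by omega) (Nat.lt_pow_self hp1)
    rw [hQ]
    simp only
    rw [padicValRat.div (Finset.prod_ne_zero_iff.2 fun i _ => hpos _ _ (hα i).1)
      (Finset.prod_ne_zero_iff.2 fun i _ => hpos _ _ (hβ i).1),
      aux_val_prod p _ _ (fun i => hpos _ _ (hα i).1),
      aux_val_prod p _ _ (fun i => hpos _ _ (hβ i).1),
      Finset.sum_congr rfl fun i _ => aux_val p (α i) (hα i).1 (hα i).2 (hαN i) _ _ (hA i),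
      Finset.sum_congr rfl fun i _ => aux_val p (β i) (hβ i).1 (hβ i).2 (hβN i) _ _ (hB i),
      Finset.sum_comm, Finset.sum_comm (s := (Finset.univ : Finset (Fin s))),
      ← Finset.sum_sub_distrib]
    apply Finset.sum_congr rfl
    intro l _
    exact hT n (p ^ l) (by positivity)
  have hpl : ∀ l, 0 < p ^ l := fun l => by positivity
  have hint : ∀ n, 0 ≤ padicValRat p (Q n) := by
    intro n
    obtain ⟨L, _, h⟩ := hvalQ n
    rw [h]
    exact Finset.sum_nonneg fun l _ => hξ0 _ (hcube n _ (hpl l))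
  have hnum : ∀ x : ℚ, (x.den : ℚ) * x = x.num := fun x => Rat.den_mul_eq_num x
  refine ⟨fun n => ⟨(Q n).num, (Q n).den, aux_int (hint n), by exact_mod_cast hnum (Q n)⟩, ?_⟩
  intro v m hv
  have hnd : ∀ {a b : ℤ}, ¬ (p : ℤ) ∣ a → ¬ (p : ℤ) ∣ b → ¬ (p : ℤ) ∣ a * b := by
    intro a b ha hb h
    rcases (Nat.prime_iff_prime_int.1 hp).dvd_or_dvd h with h | h <;> contradiction
  by_cases hDv : ((∃ i, (α i : ℝ) ≤ ∑ j, (e i j : ℝ) * ((v j : ℝ) / p)) ∨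
        (∃ i, (β i : ℝ) ≤ ∑ j, (f i j : ℝ) * ((v j : ℝ) / p)))
  · -- both sides vanish modulo `p`
    have hone : ∀ n : Fin d → ℕ, (∀ j, n j % p = v j) → 1 ≤ padicValRat p (Q n) := by
      intro n hn
      obtain ⟨L, hL, h⟩ := hvalQ n
      rw [h]
      refine le_trans ?_ (Finset.single_le_sum (fun l _ => hξ0 _ (hcube n _ (hpl l)))
        (Finset.mem_Ico.2 ⟨le_refl 1, by omega⟩))
      apply hξ _ (hcube n _ (hpl 1))
      simpa [hn] using hDv
    have h1 := hone v (fun j => Nat.mod_eq_of_lt (hv j))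
    have h2 := hone (fun j => v j + p * m j) (fun j => by simp [Nat.mod_eq_of_lt (hv j)])
    have h3 := hint m
    set X := Q (fun j => v j + p * m j)
    refine ⟨X.num * (Q v).den * (Q m).den - X.den * (Q v).num * (Q m).num,
      X.den * (Q v).den * (Q m).den, ?_, ?_, ?_⟩
    · apply dvd_sub
      · exact ((aux_int' h2).mul_right _).mul_right _
      · exact ((aux_int' h1).mul_left _).mul_right _
    · exact hnd (hnd (aux_int (by omega)) (aux_int (by omega))) (aux_int h3)
    · push_cast
      rw [← hnum X, ← hnum (Q v), ← hnum (Q m)]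
      ring
  · push Not at hDv
    have hpR : (0 : ℝ) < p := by exact_mod_cast hp.pos
    have key : ∀ (γ : ℚ) (g : Fin d → ℕ), ∑ j, (g j : ℝ) * ((v j : ℝ) / p) < γ →
        ((∑ j, g j * v j : ℕ) : ℚ) < p * γ := by
      intro γ g h
      have h2 : ∑ j, (g j : ℝ) * ((v j : ℝ) / p) = (∑ j, (g j : ℝ) * v j) / p := by
        rw [Finset.sum_div]
        exact Finset.sum_congr rfl fun j _ => by ring
      rw [h2, div_lt_iff₀ hpR, mul_comm] at h
      exact_mod_cast h
    choose g hg hge using fun i => aux_lucas p (α i) (hα i).1 (hα i).2 (hαN i)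
      (∑ j, e i j * v j) (∑ j, e i j * m j) (key _ _ (hDv.1 i))
    choose k hk hke using fun i => aux_lucas p (β i) (hβ i).1 (hβ i).2 (hβN i)
      (∑ j, f i j * v j) (∑ j, f i j * m j) (key _ _ (hDv.2 i))
    have hsum : ∀ c : Fin d → ℕ,
        ∑ j, c j * (v j + p * m j) = ∑ j, c j * v j + p * ∑ j, c j * m j := by
      intro c
      rw [Finset.mul_sum, ← Finset.sum_add_distrib]
      exact Finset.sum_congr rfl fun j _ => by ring
    have hb : ∑ i, ∑ j, e i j * m j = ∑ i, ∑ j, f i j * m j := by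
      rw [Finset.sum_comm, Finset.sum_comm (s := (Finset.univ : Finset (Fin s)))]
      apply Finset.sum_congr rfl
      intro j _
      rw [← Finset.sum_mul, ← Finset.sum_mul, hbal j]
    have hH : OneMod p ((∏ i, g i) * (∏ i, k i)⁻¹) :=
      (OneMod.prod hp _ _ fun i _ => hg i).mul hp (OneMod.prod hp _ _ fun i _ => hk i).inv
    have hpp : (-(p : ℚ)) ^ (∑ i, ∑ j, f i j * m j) ≠ 0 :=
      pow_ne_zero _ (neg_ne_zero.2 (by exact_mod_cast hp.ne_zero))
    have hEq : Q (fun j => v j + p * m j) = Q v * Q m * ((∏ i, g i) * (∏ i, k i)⁻¹) := by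
      rw [hQ]
      simp only [hsum, hge, hke, Finset.prod_mul_distrib, Finset.prod_pow_eq_pow_sum, hb]
      rw [← div_eq_mul_inv, div_mul_div_comm, div_mul_div_comm]
      rw [mul_right_comm _ _ (∏ i, g i), mul_right_comm _ _ (∏ i, k i), mul_div_mul_right _ _ hpp]
    obtain ⟨x, y, hy, hxy, hh⟩ := hH
    rw [hEq]
    refine ⟨(Q v).num * (Q m).num * (x - y), (Q v).den * (Q m).den * y, hxy.mul_left _,
      hnd (hnd (aux_int (hint v)) (aux_int (hint m))) hy, ?_⟩
    push_cast
    rw [← hnum (Q v), ← hnum (Q m), ← hh]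
    ring
end
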